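/- Every antiprismatic thickening G satisfies χ(G) ≤ γ_ℓ(G). -/

import Mathlib

open SimpleGraph

namespace Paper

variable {V : Type*} {W : Type*}

/-- A graph is claw-free if no vertex has three pairwise nonadjacent neighbours. -/
def ClawFree (G : SimpleGraph V) : Prop :=
  ¬ ∃ (v a b c : V), G.Adj v a ∧ G.Adj v b ∧ G.Adj v c ∧
      ¬G.Adj a b ∧ ¬G.Adj a c ∧ ¬G.Adj b c ∧ a ≠ b ∧ a ≠ c ∧ b ≠ c

/-- A graph is quasi-line if every neighbourhood is covered by two cliques. -/
def QuasiLine (G : SimpleGraph V) : Prop :=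
  ∀ v : V, ∃ S T : Set V, G.IsClique S ∧ G.IsClique T ∧ G.neighborSet v ⊆ S ∪ T

/-- The clique number ω(G). -/
noncomputable def cliqueNum (G : SimpleGraph V) : ℕ :=
  sSup {n | ∃ s : Finset V, G.IsNClique n s}

/-- The clique number of the subgraph induced on a vertex set `S`. -/
noncomputable def cliqueNumOn (G : SimpleGraph V) (S : Set V) : ℕ :=
  sSup {n | ∃ s : Finset V, ↑s ⊆ S ∧ G.IsNClique n s}

/-- ω(v): the maximum size of a clique containing `v`. -/
noncomputable def omegaAt (G : SimpleGraph V) (v : V) : ℕ :=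
  sSup {n | ∃ s : Finset V, G.IsNClique n s ∧ v ∈ s}

/-- The degree of a vertex (as the cardinality of its neighbourhood). -/
noncomputable def degree' (G : SimpleGraph V) (v : V) : ℕ := (G.neighborSet v).ncard

/-- The maximum degree Δ(G). -/
noncomputable def maxDeg (G : SimpleGraph V) : ℕ := sSup {n | ∃ v : V, n = degree' G v}

/-- γ_ℓ(v) = ⌈(d(v)+1+ω(v))/2⌉. -/
noncomputable def gammaLocalAt (G : SimpleGraph V) (v : V) : ℕ :=
  (degree' G v + 1 + omegaAt G v + 1) / 2

/-- γ_ℓ(G) = max over vertices of γ_ℓ(v). -/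
noncomputable def gammaLocal (G : SimpleGraph V) : ℕ :=
  sSup {n | ∃ v : V, n = gammaLocalAt G v}

/-- The closed neighbourhood of a vertex. -/
def closedNbhd (G : SimpleGraph V) (v : V) : Set V := insert v (G.neighborSet v)

/-- The closed neighbourhood within an induced subgraph on `S`. -/
def closedNbhdOn (G : SimpleGraph V) (S : Set V) (v : V) : Set V := S ∩ closedNbhd G v

/-- A triad: three pairwise nonadjacent vertices. -/
def IsTriad (G : SimpleGraph V) (T : Finset V) : Prop :=
  T.card = 3 ∧ ∀ u ∈ T, ∀ w ∈ T, u ≠ w → ¬G.Adj u w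

/-- A good triad within the induced subgraph on `S`: every vertex of the induced subgraph
outside `T` has two neighbours in `T`, or a twin in `T`, or is trumped by a vertex of `T`. -/
def GoodTriadOn (G : SimpleGraph V) (S : Set V) (T : Finset V) : Prop :=
  ↑T ⊆ S ∧ IsTriad G T ∧
    ∀ v ∈ S, v ∉ T →
      (∃ t1 ∈ T, ∃ t2 ∈ T, t1 ≠ t2 ∧ G.Adj v t1 ∧ G.Adj v t2) ∨
      (∃ t ∈ T, closedNbhdOn G S v = closedNbhdOn G S t) ∨
      (∃ t ∈ T, closedNbhdOn G S v ⊂ closedNbhdOn G S t)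

/-- A good triad in `G`. -/
def GoodTriad (G : SimpleGraph V) (T : Finset V) : Prop := GoodTriadOn G Set.univ T

/-- A homogeneous pair of cliques within the induced subgraph on `S`. -/
def IsHomPairOn (G : SimpleGraph V) (S : Set V) (A B : Finset V) : Prop :=
  ↑A ⊆ S ∧ ↑B ⊆ S ∧ G.IsClique (↑A : Set V) ∧ G.IsClique (↑B : Set V) ∧
    A.Nonempty ∧ B.Nonempty ∧ Disjoint A B ∧ 3 ≤ A.card + B.card ∧
    ∀ v ∈ S, v ∉ A → v ∉ B →
      ((∀ a ∈ A, G.Adj v a) ∨ (∀ a ∈ A, ¬G.Adj v a)) ∧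
      ((∀ b ∈ B, G.Adj v b) ∨ (∀ b ∈ B, ¬G.Adj v b))

/-- A homogeneous pair of cliques in `G`. -/
def IsHomPair (G : SimpleGraph V) (A B : Finset V) : Prop := IsHomPairOn G Set.univ A B

/-- A homogeneous pair of cliques `(A,B)` is skeletal if deleting any single edge
between `A` and `B` strictly decreases the clique number of `G[A ∪ B]`. -/
def IsSkeletalPair (G : SimpleGraph V) (A B : Finset V) : Prop :=
  ∀ a ∈ A, ∀ b ∈ B, G.Adj a b →
    cliqueNumOn (G.deleteEdges {s(a, b)}) (↑A ∪ ↑B) < cliqueNumOn G (↑A ∪ ↑B)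

/-- A graph is skeletal if every homogeneous pair of cliques in it is skeletal. -/
def Skeletal (G : SimpleGraph V) : Prop :=
  ∀ A B : Finset V, IsHomPair G A B → IsSkeletalPair G A B

/-- A linear pair: no induced C₄ between `A` and `B`. -/
def IsLinearPair (G : SimpleGraph V) (A B : Finset V) : Prop :=
  ¬ ∃ a1 ∈ A, ∃ a2 ∈ A, ∃ b1 ∈ B, ∃ b2 ∈ B,
      G.Adj a1 b1 ∧ G.Adj a2 b2 ∧ ¬G.Adj a1 b2 ∧ ¬G.Adj a2 b1

/-- A homogeneous clique. -/
def IsHomogeneousClique [Fintype V] (G : SimpleGraph V) (C : Finset V) : Prop :=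
  G.IsClique (↑C : Set V) ∧ 2 ≤ C.card ∧ C.card ≤ Fintype.card V - 1 ∧
    ∀ v ∉ C, (∀ c ∈ C, G.Adj v c) ∨ (∀ c ∈ C, ¬G.Adj v c)

/-- `X` straddles the three-cliquing `(A,B,C)` if it meets more than one of `A`, `B`, `C`. -/
def Straddles (A B C : Set V) (X : Finset V) : Prop :=
  ((↑X ∩ A).Nonempty ∧ (↑X ∩ B).Nonempty) ∨
  ((↑X ∩ A).Nonempty ∧ (↑X ∩ C).Nonempty) ∨
  ((↑X ∩ B).Nonempty ∧ (↑X ∩ C).Nonempty)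

/-- A three-cliqued graph is weakly skeletal if every nonskeletal homogeneous pair
of cliques is straddling. -/
def WeaklySkeletal (G : SimpleGraph V) (A B C : Set V) : Prop :=
  ∀ X Y : Finset V, IsHomPair G X Y → ¬IsSkeletalPair G X Y →
    Straddles A B C X ∨ Straddles A B C Y

/-- A set of unordered pairs forming a matching (pairwise disjoint non-loop pairs). -/
def IsMatchingSet (M : Set (Sym2 W)) : Prop :=
  (∀ e ∈ M, ¬e.IsDiag) ∧ ∀ e ∈ M, ∀ e' ∈ M, e ≠ e' → ∀ w : W, w ∈ e → w ∉ e'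

/-- `G[D]` is a thickening of `H[R]` under the matching `M`, via the fiber map `f`. -/
structure IsThickeningBetween (H : SimpleGraph W) (M : Set (Sym2 W)) (R : Set W)
    (G : SimpleGraph V) (D : Set V) (f : V → W) : Prop where
  maps_into : ∀ v ∈ D, f v ∈ R
  fibers_nonempty : ∀ w ∈ R, ∃ v ∈ D, f v = w
  fibers_clique : ∀ w : W, G.IsClique {v | v ∈ D ∧ f v = w}
  adj_of_adj : ∀ u ∈ D, ∀ v ∈ D, f u ≠ f v → H.Adj (f u) (f v) → s(f u, f v) ∉ M → G.Adj u v
  nonadj_of_nonadj : ∀ u ∈ D, ∀ v ∈ D, f u ≠ f v → ¬H.Adj (f u) (f v) → ¬G.Adj u v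
  semi_adj : ∀ x ∈ R, ∀ y ∈ R, s(x, y) ∈ M →
    ∃ u ∈ D, ∃ v ∈ D, f u = x ∧ f v = y ∧ G.Adj u v
  semi_nonadj : ∀ x ∈ R, ∀ y ∈ R, s(x, y) ∈ M →
    ∃ u ∈ D, ∃ v ∈ D, f u = x ∧ f v = y ∧ ¬G.Adj u v

/-- `G` is a thickening of `H[R]` under `M`. -/
def IsThickeningOn (H : SimpleGraph W) (M : Set (Sym2 W)) (R : Set W)
    (G : SimpleGraph V) (f : V → W) : Prop :=
  IsThickeningBetween H M R G Set.univ f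

/-- `G` is a thickening of `H` under `M`. -/
def IsThickening (H : SimpleGraph W) (M : Set (Sym2 W)) (G : SimpleGraph V) (f : V → W) : Prop :=
  IsThickeningBetween H M Set.univ G Set.univ f

/-- A graph is antiprismatic if every vertex outside a triad has exactly two
neighbours in it. -/
def Antiprismatic (H : SimpleGraph W) : Prop :=
  ∀ T : Finset W, IsTriad H T → ∀ v ∉ T,
    ∃ t ∈ T, ¬H.Adj v t ∧ ∀ t' ∈ T, t' ≠ t → H.Adj v t'

/-- A changeable matching in an antiprismatic graph. -/
def ChangeableMatching (H : SimpleGraph W) (M : Set (Sym2 W)) : Prop :=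
  M ⊆ H.edgeSet ∧ IsMatchingSet M ∧ ∀ M' ⊆ M, Antiprismatic (H.deleteEdges M')



/-- The icosahedron `G0` on vertices `v0, …, v11`. -/
def icoG0 : SimpleGraph (Fin 12) :=
  SimpleGraph.fromRel (fun i j =>
    (1 ≤ i.val ∧ i.val ≤ 10 ∧ (j.val = i.val % 10 + 1 ∨ j.val = (i.val + 1) % 10 + 1)) ∨
    (i.val = 0 ∧ j.val % 2 = 1 ∧ 1 ≤ j.val ∧ j.val ≤ 10) ∨
    (i.val = 11 ∧ j.val % 2 = 0 ∧ 1 ≤ j.val ∧ j.val ≤ 10))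

/-- `G1 = G0 − v11`. -/
def icoG1 : SimpleGraph (Fin 11) :=
  SimpleGraph.fromRel (fun i j =>
    (1 ≤ i.val ∧ (j.val = i.val % 10 + 1 ∨ j.val = (i.val + 1) % 10 + 1)) ∨
    (i.val = 0 ∧ j.val % 2 = 1))

/-- `G2 = G1 − v10`. -/
def icoG2 : SimpleGraph (Fin 10) :=
  SimpleGraph.fromRel (fun i j =>
    (1 ≤ i.val ∧ (j.val = i.val % 10 + 1 ∨ j.val = (i.val + 1) % 10 + 1)) ∨
    (i.val = 0 ∧ j.val % 2 = 1))

/-- An icosahedral thickening: a proper thickening of `G0` or `G1`, or a thickening of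
`G2 ∪ M` under a matching `M ⊆ {v1v4, v6v9}`. -/
def IsIcosahedralThickening (G : SimpleGraph V) : Prop :=
  (∃ f : V → Fin 12, IsThickening icoG0 ∅ G f) ∨
  (∃ f : V → Fin 11, IsThickening icoG1 ∅ G f) ∨
  (∃ (M : Set (Sym2 (Fin 10))) (f : V → Fin 10),
      M ⊆ {s((1 : Fin 10), 4), s(6, 9)} ∧
      IsThickening (icoG2 ⊔ SimpleGraph.fromEdgeSet M) M G f)

/-! ### Antihat graphs -/

/-- The vertex type of the antihat base graph: `A = {a0,…,ak}`, `B = {b0,…,bk}`,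
`C = {c1,…,ck}` (the third component `i` encodes `c_{i+1}`). -/
abbrev AHV (k : ℕ) : Type := Fin (k + 1) ⊕ Fin (k + 1) ⊕ Fin k

def ahA {k : ℕ} (i : Fin (k + 1)) : AHV k := Sum.inl i
def ahB {k : ℕ} (i : Fin (k + 1)) : AHV k := Sum.inr (Sum.inl i)
def ahC {k : ℕ} (i : Fin k) : AHV k := Sum.inr (Sum.inr i)

/-- The antihat base graph `H`, where `e00` records whether `a0` and `b0` are adjacent. -/
def antihatH (k : ℕ) (e00 : Bool) : SimpleGraph (AHV k) :=
  SimpleGraph.fromRel (fun x y =>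
    match x, y with
    | Sum.inl _, Sum.inl _ => True
    | Sum.inr (Sum.inl _), Sum.inr (Sum.inl _) => True
    | Sum.inr (Sum.inr _), Sum.inr (Sum.inr _) => True
    | Sum.inl i, Sum.inr (Sum.inl j) =>
        (i = j ∧ 1 ≤ i.val) ∨ (i.val = 0 ∧ j.val = 0 ∧ e00 = true)
    | Sum.inl i, Sum.inr (Sum.inr j) => 1 ≤ i.val ∧ i.val ≠ j.val + 1
    | Sum.inr (Sum.inl i), Sum.inr (Sum.inr j) => 1 ≤ i.val ∧ i.val ≠ j.val + 1
    | _, _ => False)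

/-- The conditions on the matching `M` of an antihat thickening with deleted set `Xd`. -/
def AntihatM (k : ℕ) (e00 : Bool) (Xd : Finset (AHV k)) (M : Set (Sym2 (AHV k))) : Prop :=
  IsMatchingSet M ∧
  (∀ e ∈ M, ∀ w : AHV k, w ∈ e → w ∉ Xd) ∧
  (∀ i j : Fin (k + 1), s(ahA i, ahA j) ∉ M) ∧
  (∀ i j : Fin (k + 1), s(ahB i, ahB j) ∉ M) ∧
  (∀ i j : Fin k, s(ahC i, ahC j) ∉ M) ∧
  (e00 = true → s(ahA (0 : Fin (k + 1)), ahB (0 : Fin (k + 1))) ∈ M) ∧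
  (∀ i j : Fin (k + 1), 1 ≤ i.val → 1 ≤ j.val → s(ahA i, ahB j) ∈ M →
      i = j ∧ ∃ c : Fin k, c.val + 1 = i.val ∧ ahC c ∈ Xd) ∧
  (∀ i : Fin (k + 1), ∀ j : Fin k, 1 ≤ i.val → s(ahB i, ahC j) ∈ M →
      i.val = j.val + 1 ∧ ahA i ∈ Xd) ∧
  (∀ i : Fin (k + 1), ∀ j : Fin k, 1 ≤ i.val → s(ahA i, ahC j) ∈ M →
      i.val = j.val + 1 ∧ ahB i ∈ Xd)

/-! ### Strips and generalized 2-joins -/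

/-- The induced subgraph on `S` contains an induced `W5` (a 5-wheel). -/
def HasInducedW5On (G : SimpleGraph V) (S : Set V) : Prop :=
  ∃ w c0 c1 c2 c3 c4 : V,
    w ∈ S ∧ c0 ∈ S ∧ c1 ∈ S ∧ c2 ∈ S ∧ c3 ∈ S ∧ c4 ∈ S ∧
    G.Adj w c0 ∧ G.Adj w c1 ∧ G.Adj w c2 ∧ G.Adj w c3 ∧ G.Adj w c4 ∧
    G.Adj c0 c1 ∧ G.Adj c1 c2 ∧ G.Adj c2 c3 ∧ G.Adj c3 c4 ∧ G.Adj c4 c0 ∧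
    c0 ≠ c2 ∧ c0 ≠ c3 ∧ c1 ≠ c3 ∧ c1 ≠ c4 ∧ c2 ≠ c4 ∧
    ¬G.Adj c0 c2 ∧ ¬G.Adj c0 c3 ∧ ¬G.Adj c1 c3 ∧ ¬G.Adj c1 c4 ∧ ¬G.Adj c2 c4

/-- A generalized 2-join `((X1,Y1),(X2,Y2))` of `G` separating `V1` from `V2`,
with `X1, X2, Y1, Y2` pairwise disjoint except possibly `X1` and `Y1`. -/
structure IsGen2Join [Fintype V] [DecidableEq V] (G : SimpleGraph V)
    (V1 V2 X1 Y1 X2 Y2 : Finset V) : Prop where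
  disjV : Disjoint V1 V2
  unionV : V1 ∪ V2 = Finset.univ
  subX1 : X1 ⊆ V1
  subY1 : Y1 ⊆ V1
  subX2 : X2 ⊆ V2
  subY2 : Y2 ⊆ V2
  cliqueX : G.IsClique (↑X1 ∪ ↑X2 : Set V)
  cliqueY : G.IsClique (↑Y1 ∪ ↑Y2 : Set V)
  cross : ∀ u ∈ V1, ∀ v ∈ V2, G.Adj u v → (u ∈ X1 ∧ v ∈ X2) ∨ (u ∈ Y1 ∧ v ∈ Y2)
  disjX2Y2 : Disjoint X2 Y2

/-- ω'(v): the maximum size of a clique of `H2 = G[V2 ∪ X1 ∪ Y1]` containing `v`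
and not intersecting both `X1 ∖ Y1` and `Y1 ∖ X1`. -/
noncomputable def omegaJ [DecidableEq V] (G : SimpleGraph V) (V2 X1 Y1 : Finset V) (v : V) : ℕ :=
  sSup {n | ∃ s : Finset V, G.IsNClique n s ∧ v ∈ s ∧ s ⊆ V2 ∪ X1 ∪ Y1 ∧
      ¬((∃ x ∈ s, x ∈ X1 ∧ x ∉ Y1) ∧ ∃ y ∈ s, y ∈ Y1 ∧ y ∉ X1)}

/-- γ_ℓ^j(H2) = max over `v ∈ V2 ∪ X1 ∪ Y1` of ⌈(d_G(v)+1+ω'(v))/2⌉. -/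
noncomputable def gammaLJ [DecidableEq V] (G : SimpleGraph V) (V2 X1 Y1 : Finset V) : ℕ :=
  (V2 ∪ X1 ∪ Y1).sup fun v => (degree' G v + 1 + omegaJ G V2 X1 Y1 v + 1) / 2

/-- `(G[V2], X2, Y2)` is an antihat strip. -/
def IsAntihatStripOn (G : SimpleGraph V) (V2 X2 Y2 : Finset V) : Prop :=
  ∃ (k : ℕ) (e00 : Bool) (Xd : Finset (AHV k)) (M : Set (Sym2 (AHV k))) (f : V → AHV k),
    2 ≤ k ∧ ahA (0 : Fin (k + 1)) ∉ Xd ∧ ahB (0 : Fin (k + 1)) ∉ Xd ∧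
    (∃ i j : Fin k, i ≠ j ∧ ahC i ∉ Xd ∧ ahC j ∉ Xd) ∧
    AntihatM k e00 Xd M ∧
    IsThickeningBetween (antihatH k e00 ⊔ SimpleGraph.fromEdgeSet M) M
      ((↑Xd ∪ {ahA (0 : Fin (k + 1)), ahB (0 : Fin (k + 1))} : Set (AHV k))ᶜ)
      G (↑V2 : Set V) f ∧
    (↑X2 : Set V) = {v | v ∈ V2 ∧ ∃ i : Fin (k + 1), 1 ≤ i.val ∧ f v = ahA i ∧ ahA i ∉ Xd} ∧
    (↑Y2 : Set V) = {v | v ∈ V2 ∧ ∃ i : Fin (k + 1), 1 ≤ i.val ∧ f v = ahB i ∧ ahB i ∉ Xd} ∧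
    HasInducedW5On G (↑V2 : Set V)

/-- The base graph of strange strips, on `a1=0, a2=1, b1=2, b2=3, b3=4, c1=5, c2=6`. -/
def strangeH : SimpleGraph (Fin 7) :=
  SimpleGraph.fromEdgeSet
    {s(0, 1), s(2, 3), s(2, 4), s(3, 4), s(5, 6),
     s(0, 2), s(1, 5), s(3, 5), s(4, 5), s(0, 6), s(1, 6), s(2, 6), s(3, 6)}

/-- The matching `{b3c1, b2c2}` of strange strips. -/
def strangeM : Set (Sym2 (Fin 7)) := {s(4, 5), s(3, 6)}

/-- `(G[V2], X2, Y2)` is a strange strip. -/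
def IsStrangeStripOn (G : SimpleGraph V) (V2 X2 Y2 : Finset V) : Prop :=
  ∃ f : V → Fin 7,
    IsThickeningBetween strangeH strangeM Set.univ G (↑V2 : Set V) f ∧
    (↑X2 : Set V) = {v | v ∈ V2 ∧ (f v = 0 ∨ f v = 1)} ∧
    (↑Y2 : Set V) = {v | v ∈ V2 ∧ (f v = 2 ∨ f v = 3 ∨ f v = 4)}

/-- The base graph of gear strips, on `v1, …, v10` (as `0, …, 9`). -/
def gearH : SimpleGraph (Fin 10) :=
  SimpleGraph.fromEdgeSet
    {s(0, 1), s(1, 2), s(2, 3), s(3, 4), s(4, 5), s(0, 5),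
     s(6, 0), s(6, 1), s(6, 2), s(6, 5),
     s(7, 2), s(7, 3), s(7, 4), s(7, 5), s(7, 6),
     s(8, 0), s(8, 2), s(8, 3), s(8, 5), s(8, 6), s(8, 7),
     s(9, 1), s(9, 2), s(9, 4), s(9, 5), s(9, 6), s(9, 7)}

/-- `(G[V2], X2, Y2)` is a gear strip. -/
def IsGearStripOn (G : SimpleGraph V) (V2 X2 Y2 : Finset V) : Prop :=
  ∃ (Xd : Finset (Fin 10)) (M : Set (Sym2 (Fin 10))) (f : V → Fin 10),
    Xd ⊆ {8, 9} ∧ M ⊆ {s((6 : Fin 10), 7)} ∧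
    IsThickeningBetween gearH M ((↑Xd : Set (Fin 10))ᶜ) G (↑V2 : Set V) f ∧
    (↑X2 : Set V) = {v | v ∈ V2 ∧ (f v = 0 ∨ f v = 1)} ∧
    (↑Y2 : Set V) = {v | v ∈ V2 ∧ (f v = 3 ∨ f v = 4)}

/-! ### The two exceptional three-cliqued classes -/

/-- The base graph of Exception I, on `v1, …, v8` (as `0, …, 7`);
`b` records whether `v2v5` is an edge. -/
def exIG (b : Bool) : SimpleGraph (Fin 8) :=
  SimpleGraph.fromEdgeSet
    ({s(0, 1), s(0, 2), s(0, 5), s(0, 6), s(1, 2), s(1, 3), s(2, 3), s(2, 4), s(3, 4),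
      s(3, 5), s(4, 5), s(5, 6), s(6, 7)} ∪ (if b then {s(1, 4)} else ∅))

/-- The matching of Exception I: `{v1v4, v3v6}`, plus `v2v5` when present. -/
def exIM (b : Bool) : Set (Sym2 (Fin 8)) :=
  {s(0, 3), s(2, 5)} ∪ (if b then {s(1, 4)} else ∅)

/-- The base graph of Exception II, on `v1, …, v9` (as `0, …, 8`); `b24` records
whether `v2v4` is an edge and `b75` whether `v7v5` is an edge. -/
def exIIG (b24 b75 : Bool) : SimpleGraph (Fin 9) :=
  SimpleGraph.fromEdgeSet
    ({s(0, 1), s(6, 7),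
      s(2, 3), s(2, 4), s(2, 5), s(2, 8), s(3, 4), s(3, 5), s(3, 8), s(4, 5), s(4, 8), s(5, 8),
      s(0, 2), s(0, 7), s(0, 8), s(5, 7), s(7, 8), s(1, 2), s(5, 6)}
      ∪ (if b24 then {s(1, 3)} else ∅) ∪ (if b75 then {s(4, 6)} else ∅))

/-! ### Circular interval representations -/

/-- Membership in the (closed) arc from `s` to `t` of the circle `[0,1)`,
going in increasing direction and possibly wrapping around. -/
def ArcMem (s t x : ℝ) : Prop := if s ≤ t then s ≤ x ∧ x ≤ t else (s ≤ x ∨ x ≤ t)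

/-- Local bound on the subset `S`: for all cliques through `v`. -/
def LocBound {V : Type*} (G : SimpleGraph V) (S : Finset V) (k : ℕ) : Prop :=
  ∀ v ∈ S, ∀ C ⊆ S, G.IsClique (C : Set V) → v ∈ C →
    {y ∈ (S : Set V) | G.Adj v y}.ncard + 1 + C.card ≤ 2 * k

/-- `G[S]` is `k`-colourable. -/
def ColOn {V : Type*} (G : SimpleGraph V) (S : Finset V) (k : ℕ) : Prop :=
  ∃ c : V → ℕ, (∀ x ∈ S, c x < k) ∧ ∀ x ∈ S, ∀ y ∈ S, G.Adj x y → c x ≠ c y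

/-- Involutions supported on `S` pairing nonadjacent vertices. -/
def IsPM {V : Type*} (G : SimpleGraph V) (S : Finset V) (f : V → V) : Prop :=
  (∀ x, f (f x) = x) ∧ (∀ x, ¬G.Adj x (f x)) ∧ ∀ x, x ∉ S → f x = x

/-- The fixed points of `f` in `S`. -/
noncomputable def fixS {V : Type*} (S : Finset V) (f : V → V) : Finset V :=
  open Classical in S.filter (fun x => f x = x)

theorem mem_fixS {V : Type*} {S : Finset V} {f : V → V} {x : V} :
    x ∈ fixS S f ↔ x ∈ S ∧ f x = x := by
  classical
  simp [fixS]

theorem colOn_of_image {V : Type*} {G : SimpleGraph V} {S : Finset V} {k : ℕ} (c : V → ℕ)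
    (hk : (S.image c).card ≤ k)
    (hc : ∀ x ∈ S, ∀ y ∈ S, G.Adj x y → c x ≠ c y) : ColOn G S k := by
  classical
  let e := (S.image c).equivFin
  refine ⟨fun x => if h : c x ∈ S.image c then (e ⟨c x, h⟩ : ℕ) else 0, ?_, ?_⟩
  · intro x hx
    have h : c x ∈ S.image c := Finset.mem_image_of_mem _ hx
    simp only [h, dite_true]
    exact lt_of_lt_of_le (e ⟨c x, h⟩).2 hk
  · intro x hx y hy hxy
    have h : c x ∈ S.image c := Finset.mem_image_of_mem _ hx
    have h' : c y ∈ S.image c := Finset.mem_image_of_mem _ hy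
    simp only [h, h', dite_true]
    intro heq
    have := e.injective (Fin.ext heq)
    exact hc x hx y hy hxy (by simpa using this)

theorem ColOn.mono {V : Type*} {G : SimpleGraph V} {S : Finset V} {k l : ℕ} (hkl : k ≤ l)
    (h : ColOn G S k) : ColOn G S l := by
  obtain ⟨c, h1, h2⟩ := h
  exact ⟨c, fun x hx => lt_of_lt_of_le (h1 x hx) hkl, h2⟩

theorem LocBound.subset {V : Type*} {G : SimpleGraph V} {S S' : Finset V} {k : ℕ}
    (h : LocBound G S k) (hs : S' ⊆ S) : LocBound G S' k := by
  intro v hv C hC hcl hvC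
  have := h v (hs hv) C (hC.trans hs) hcl hvC
  have h2 : {y ∈ (S' : Set V) | G.Adj v y}.ncard ≤ {y ∈ (S : Set V) | G.Adj v y}.ncard := by
    apply Set.ncard_le_ncard
    · intro y hy
      exact ⟨hs hy.1, hy.2⟩
    · exact S.finite_toSet.subset (fun y hy => hy.1)
  omega

theorem pm_orbits {V : Type*} [Finite V] {G : SimpleGraph V} {S : Finset V} {f : V → V}
    (hf : IsPM G S f) : ∃ k, 2 * k = S.card + (fixS S f).card ∧ ColOn G S k := by
  classical
  obtain ⟨n, ⟨e⟩⟩ := Finite.exists_equiv_fin V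
  obtain ⟨h1, h2, h3⟩ := hf
  have hS : ∀ x ∈ S, f x ∈ S := by
    intro x hx
    by_contra hn
    have := h3 _ hn
    rw [h1] at this
    exact hn (this ▸ hx)
  let r : V → ℕ := fun x => (e x : ℕ)
  have hr : ∀ x y, r x = r y → x = y := fun x y h => e.injective (Fin.ext h)
  let c : V → ℕ := fun x => min (r x) (r (f x))
  let L := S.filter (fun x => r x < r (f x))
  let L' := S.filter (fun x => r (f x) < r x)
  have hLL : L.card = L'.card := by
    apply Finset.card_bij (fun x _ => f x)
    · intro a ha
      simp only [L, L', Finset.mem_filter] at ha ⊢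
      rw [h1]
      exact ⟨hS _ ha.1, ha.2⟩
    · intro a _ b _ hab
      rw [← h1 a, hab, h1]
    · intro b hb
      simp only [L, L', Finset.mem_filter] at hb ⊢
      exact ⟨f b, ⟨hS _ hb.1, by rw [h1]; exact hb.2⟩, h1 b⟩
  have hsum : S.card = L.card + (fixS S f).card + L'.card := by
    have e1 : S = (L ∪ fixS S f) ∪ L' := by
      ext x
      simp only [L, L', Finset.mem_union, Finset.mem_filter, mem_fixS]
      constructor
      · intro hx
        rcases lt_trichotomy (r x) (r (f x)) with h | h | h
        · exact Or.inl (Or.inl ⟨hx, h⟩)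
        · exact Or.inl (Or.inr ⟨hx, (hr _ _ h).symm⟩)
        · exact Or.inr ⟨hx, h⟩
      · tauto
    have d1 : Disjoint L (fixS S f) := by
      rw [Finset.disjoint_left]
      intro x hx hx'
      simp only [L, Finset.mem_filter, mem_fixS] at hx hx'
      rw [hx'.2] at hx
      exact lt_irrefl _ hx.2
    have d2 : Disjoint (L ∪ fixS S f) L' := by
      rw [Finset.disjoint_left]
      intro x hx hx'
      simp only [L, L', Finset.mem_union, Finset.mem_filter, mem_fixS] at hx hx'
      rcases hx with hx | hx
      · omega
      · rw [hx.2] at hx'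
        exact lt_irrefl _ hx'.2
    conv_lhs => rw [e1]
    rw [Finset.card_union_of_disjoint d2, Finset.card_union_of_disjoint d1]
  refine ⟨L.card + (fixS S f).card, by omega, ?_⟩
  apply colOn_of_image c
  · have : S.image c ⊆ (L ∪ fixS S f).image r := by
      intro m hm
      obtain ⟨x, hx, rfl⟩ := Finset.mem_image.1 hm
      rw [Finset.mem_image]
      simp only [L, Finset.mem_union, Finset.mem_filter, mem_fixS, c]
      rcases lt_trichotomy (r x) (r (f x)) with h | h | h
      · exact ⟨x, Or.inl ⟨hx, h⟩, by omega⟩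
      · exact ⟨x, Or.inr ⟨hx, (hr _ _ h).symm⟩, by omega⟩
      · exact ⟨f x, Or.inl ⟨hS _ hx, by rw [h1]; exact h⟩, by omega⟩
    calc (S.image c).card ≤ ((L ∪ fixS S f).image r).card := Finset.card_le_card this
      _ ≤ (L ∪ fixS S f).card := Finset.card_image_le
      _ ≤ _ := Finset.card_union_le _ _
  · intro x _ y _ hxy heq
    simp only [c] at heq
    have : r x = r y ∨ r x = r (f y) ∨ r (f x) = r y ∨ r (f x) = r (f y) := by omega
    rcases this with h | h | h | h
    · exact hxy.ne (hr _ _ h)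
    · have := hr _ _ h
      exact h2 y (this ▸ hxy.symm)
    · have := hr _ _ h
      exact h2 x (this ▸ hxy)
    · have := hr _ _ h
      exact hxy.ne (by rw [← h1 x, this, h1])

/-- Optimal (maximum) matchings. -/
def IsOpt {V : Type*} (G : SimpleGraph V) (S : Finset V) (f : V → V) : Prop :=
  IsPM G S f ∧ ∀ g, IsPM G S g → (fixS S f).card ≤ (fixS S g).card

theorem exists_opt {V : Type*} (G : SimpleGraph V) (S : Finset V) : ∃ f, IsOpt G S f := by
  classical
  have hne : ∃ n, ∃ f, IsPM G S f ∧ (fixS S f).card = n :=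
    ⟨_, id, ⟨fun _ => rfl, fun x => G.loopless.irrefl x, fun _ _ => rfl⟩, rfl⟩
  obtain ⟨f, hf, hn⟩ := Nat.find_spec hne
  refine ⟨f, hf, fun g hg => ?_⟩
  rw [hn]
  exact Nat.find_min' hne ⟨g, hg, rfl⟩

/-- Two distinct nonadjacent vertices are not both missed by an optimal matching. -/
theorem opt_adj {V : Type*} {G : SimpleGraph V} {S : Finset V} {f : V → V} (hf : IsOpt G S f)
    {a b : V} (ha : a ∈ S) (hb : b ∈ S) (hab : a ≠ b) (hfa : f a = a) (hfb : f b = b) :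
    G.Adj a b := by
  classical
  by_contra hn
  obtain ⟨⟨h1, h2, h3⟩, hmin⟩ := hf
  have hn' : ¬G.Adj b a := fun h => hn h.symm
  let g : V → V := fun x => if x = a then b else if x = b then a else f x
  have hg : IsPM G S g := by
    refine ⟨?_, ?_, ?_⟩
    · intro x
      simp only [g]
      grind
    · intro x
      simp only [g]
      grind
    · intro x hx
      simp only [g]
      grind
  have hss : fixS S g ⊆ (fixS S f).erase a := by
    intro x hx
    rw [Finset.mem_erase]
    rw [mem_fixS] at hx ⊢
    simp only [g] at hx
    grind
  have := Finset.card_le_card hss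
  rw [Finset.card_erase_of_mem (mem_fixS.2 ⟨ha, hfa⟩)] at this
  have h0 : 0 < (fixS S f).card := Finset.card_pos.2 ⟨a, mem_fixS.2 ⟨ha, hfa⟩⟩
  have := hmin g hg
  omega

/-- Gallai's lemma (transitivity form). -/
theorem gallai_trans {V : Type*} {G : SimpleGraph V} {S : Finset V}
    {u t v : V} (hu : u ∈ S) (hv : v ∈ S) (huv : u ≠ v)
    (hcrit : ∃ f, IsOpt G S f ∧ f t = t)
    (h1 : ∀ f, IsOpt G S f → f u = u → f t ≠ t)
    (h2 : ∀ f, IsOpt G S f → f v = v → f t ≠ t)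
    (M : V → V) (hM : IsOpt G S M) (hMu : M u = u) (hMv : M v = v) : False := by
  classical
  let ag : (V → V) → ℕ := fun N => (S.filter (fun x => M x ≠ x ∧ N x = M x)).card
  -- choose N with maximal agreement
  obtain ⟨N, ⟨hN, hNt⟩, hmax⟩ : ∃ N, (IsOpt G S N ∧ N t = t) ∧
      ∀ N', IsOpt G S N' → N' t = t → ag N' ≤ ag N := by
    have hb : ∀ N, ag N ≤ S.card := fun N => Finset.card_filter_le _ _
    have hne : ∃ n, ∃ f, (IsOpt G S f ∧ f t = t) ∧ S.card - ag f = n := by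
      obtain ⟨f, hf⟩ := hcrit
      exact ⟨_, f, hf, rfl⟩
    obtain ⟨N, hN, hn⟩ := Nat.find_spec hne
    refine ⟨N, hN, fun N' h h' => ?_⟩
    have := Nat.find_min' hne ⟨N', ⟨h, h'⟩, rfl⟩
    have := hb N'
    have := hb N
    omega
  have hcard : (fixS S N).card = (fixS S M).card := le_antisymm (hN.2 _ hM.1) (hM.2 _ hN.1)
  have hNu : N u ≠ u := fun h => h1 N hN h hNt
  have hNv : N v ≠ v := fun h => h2 N hN h hNt
  have hsd : (fixS S M \ fixS S N).card = (fixS S N \ fixS S M).card :=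
    Finset.card_sdiff_comm hcard.symm
  have h2c : 1 < (fixS S N \ fixS S M).card := by
    rw [← hsd, Finset.one_lt_card]
    refine ⟨u, ?_, v, ?_, huv⟩
    · simp [mem_fixS, hu, hMu, hNu]
    · simp [mem_fixS, hv, hMv, hNv]
  obtain ⟨x, hx, hxt⟩ := Finset.exists_mem_ne h2c t
  simp only [Finset.mem_sdiff, mem_fixS, not_and] at hx
  obtain ⟨⟨hxS, hNx⟩, hMx⟩ := hx
  replace hMx := hMx hxS
  obtain ⟨⟨m1, m2, m3⟩, -⟩ := hM
  have hN0 := hN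
  obtain ⟨⟨n1, n2, n3⟩, nmin⟩ := hN
  obtain ⟨y, hy⟩ : ∃ y, y = M x := ⟨_, rfl⟩
  have hyx : y ≠ x := hy ▸ hMx
  have hMy : M y = x := by rw [hy, m1]
  have hyS : y ∈ S := by
    by_contra hc
    have := m3 y hc
    exact hyx (this ▸ hMy)
  have hnxy : ¬G.Adj x y := hy ▸ m2 x
  have hnyx : ¬G.Adj y x := fun h => hnxy h.symm
  have hNy : N y ≠ y := fun h => hnxy (opt_adj hN0 hxS hyS hyx.symm hNx h)
  obtain ⟨z, hz⟩ : ∃ z, z = N y := ⟨_, rfl⟩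
  have hNz : N z = y := by rw [hz, n1]
  have hzy : z ≠ y := hz ▸ hNy
  have hzx : z ≠ x := by
    intro h
    rw [h, hNx] at hNz
    exact hyx hNz.symm
  have hzS : z ∈ S := by
    by_contra hc
    have := n3 z hc
    exact hzy (this ▸ hNz)
  let g : V → V := fun a => if a = x then y else if a = y then x else if a = z then z else N a
  have hg : IsPM G S g := by
    refine ⟨?_, ?_, ?_⟩
    · intro a
      have := n1 a
      simp only [g]
      grind
    · intro a
      have := n2 a
      have := G.loopless.irrefl a
      simp only [g]
      grind
    · intro a ha
      have := n3 a ha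
      simp only [g]
      grind
  have hfix : fixS S g ⊆ insert z ((fixS S N).erase x) := by
    intro a ha
    rw [Finset.mem_insert, Finset.mem_erase]
    rw [mem_fixS] at ha ⊢
    simp only [g] at ha
    grind
  have hgc : (fixS S g).card ≤ (fixS S N).card := by
    have e1 := Finset.card_le_card hfix
    have e2 := Finset.card_insert_le z ((fixS S N).erase x)
    have e3 := Finset.card_erase_of_mem (mem_fixS.2 ⟨hxS, hNx⟩)
    have e4 : 0 < (fixS S N).card := Finset.card_pos.2 ⟨x, mem_fixS.2 ⟨hxS, hNx⟩⟩
    omega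
  have hgO : IsOpt G S g := ⟨hg, fun g' hg' => hgc.trans (nmin g' hg')⟩
  have hgt : g t = t := by
    simp only [g]
    grind
  have hle := hmax g hgO hgt
  have hlt : ag N < ag g := by
    apply Finset.card_lt_card
    rw [Finset.ssubset_iff_of_subset]
    · refine ⟨x, ?_, ?_⟩
      · simp only [Finset.mem_filter, g]
        grind
      · simp only [Finset.mem_filter]
        grind
    · intro a ha
      simp only [Finset.mem_filter, g] at ha ⊢
      have := m1 a
      grind
  omega

/-- The case of stability number at most two, existence of a good matching. -/
theorem base_pm {V : Type*} [Finite V] {G : SimpleGraph V} (k : ℕ) (n : ℕ) :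
    ∀ S : Finset V, S.card = n →
    (∀ a ∈ S, ∀ b ∈ S, ∀ c ∈ S, a ≠ b → a ≠ c → b ≠ c →
      G.Adj a b ∨ G.Adj a c ∨ G.Adj b c) → LocBound G S k →
    ∃ f, IsPM G S f ∧ S.card + (fixS S f).card ≤ 2 * k := by
  classical
  induction n with
  | zero =>
    intro S hS _ _
    obtain ⟨f, hf⟩ := exists_opt G S
    have : S = ∅ := Finset.card_eq_zero.1 hS
    subst this
    exact ⟨f, hf.1, by simp [fixS]⟩
  | succ n ih =>
    intro S hS hα hB
    by_cases hcrit : ∀ v ∈ S, ∃ f, IsOpt G S f ∧ f v = v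
    · -- critical case
      let cod : V → Finset V := fun v => S.filter (fun y => y ≠ v ∧ ¬G.Adj v y)
      have hSne : S.Nonempty := Finset.card_pos.1 (by omega)
      obtain ⟨v, hv, hmin⟩ := Finset.exists_min_image S (fun v => (cod v).card) hSne
      obtain ⟨f, hf, hfv⟩ := hcrit v hv
      have hvF : v ∈ fixS S f := mem_fixS.2 ⟨hv, hfv⟩
      have hdeg : {y ∈ (S : Set V) | G.Adj v y}.ncard + 1 + (cod v).card = S.card := by
        have e0 : {y ∈ (S : Set V) | G.Adj v y} = ((S.filter (fun y => G.Adj v y) : Finset V) : Set V) := by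
          ext y; simp
        rw [e0, Set.ncard_coe_finset]
        have e1 : S = insert v (S.filter (fun y => G.Adj v y) ∪ cod v) := by
          ext y
          simp only [cod, Finset.mem_insert, Finset.mem_union, Finset.mem_filter]
          grind
        have e2 : v ∉ S.filter (fun y => G.Adj v y) ∪ cod v := by
          simp [cod]
        have e3 : Disjoint (S.filter (fun y => G.Adj v y)) (cod v) := by
          rw [Finset.disjoint_left]
          intro y hy hy'
          simp only [cod, Finset.mem_filter] at hy hy'
          exact hy'.2.2 hy.2
        conv_rhs => rw [e1]
        rw [Finset.card_insert_of_notMem e2, Finset.card_union_of_disjoint e3]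
        omega
      have hF : G.IsClique (fixS S f : Set V) := by
        intro a ha b hb hab
        have ha := mem_fixS.1 ha
        have hb := mem_fixS.1 hb
        exact opt_adj hf ha.1 hb.1 hab ha.2 hb.2
      have hFS : fixS S f ⊆ S := fun x hx => (mem_fixS.1 hx).1
      have key : S.card + (fixS S f).card ≤ 2 * k + 1 := by
        by_cases hc0 : (cod v).card = 0
        · have := hB v hv _ hFS hF hvF
          omega
        · obtain ⟨u, hu⟩ := Finset.card_pos.1 (Nat.pos_of_ne_zero hc0)
          simp only [cod, Finset.mem_filter] at hu
          obtain ⟨huS, huv, hnvu⟩ := hu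
          have hnR : ∀ a ∈ S, ∀ b ∈ S, a ≠ b → ¬G.Adj a b → ∀ f, IsOpt G S f → f a = a → f b ≠ b :=
            fun a ha b hb hab hn f hf hfa hfb => hn (opt_adj hf ha hb hab hfa hfb)
          have hyR : ∀ y ∈ cod u, y ≠ v → ∀ f, IsOpt G S f → f v = v → f y ≠ y := by
            intro y hy hyv f hf hfv hfy
            simp only [cod, Finset.mem_filter] at hy
            refine gallai_trans hy.1 hv hyv (hcrit u huS) ?_ ?_ f hf hfy hfv
            · exact hnR y hy.1 u huS hy.2.1 (fun h => hy.2.2 h.symm)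
            · exact hnR v hv u huS huv.symm hnvu
          have hcross : ∀ y ∈ cod u, ∀ w ∈ (fixS S f).erase v, y ≠ w ∧ G.Adj y w := by
            intro y hy w hw
            rw [Finset.mem_erase, mem_fixS] at hw
            obtain ⟨hwv, hwS, hfw⟩ := hw
            have hyS : y ∈ S := (Finset.mem_filter.1 hy).1
            have hyw : y ≠ w := by
              rintro rfl
              exact hyR y hy hwv f hf hfv hfw
            refine ⟨hyw, ?_⟩
            by_contra hn
            by_cases hyv : y = v
            · subst hyv
              exact hn (opt_adj hf hyS hwS hyw hfv hfw)
            · refine gallai_trans hwS hv hwv (hcrit y hyS) ?_ ?_ f hf hfw hfv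
              · exact hnR w hwS y hyS hyw.symm (fun h => hn h.symm)
              · exact hyR y hy hyv
          have hvu : v ∈ cod u := by
            simp only [cod, Finset.mem_filter]
            exact ⟨hv, huv.symm, fun h => hnvu h.symm⟩
          have hCS : cod u ∪ (fixS S f).erase v ⊆ S :=
            Finset.union_subset (Finset.filter_subset _ _) ((Finset.erase_subset _ _).trans hFS)
          have hCcl : G.IsClique ((cod u ∪ (fixS S f).erase v : Finset V) : Set V) := by
            intro a ha b hb hab
            rw [Finset.mem_coe, Finset.mem_union] at ha hb
            rcases ha with ha | ha <;> rcases hb with hb | hb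
            · simp only [cod, Finset.mem_filter] at ha hb
              have := hα a ha.1 b hb.1 u huS hab ha.2.1 hb.2.1
              rcases this with h | h | h
              · exact h
              · exact absurd h.symm ha.2.2
              · exact absurd h.symm hb.2.2
            · exact (hcross a ha b hb).2
            · exact (hcross b hb a ha).2.symm
            · exact hF (Finset.mem_of_mem_erase ha) (Finset.mem_of_mem_erase hb) hab
          have hdis : Disjoint (cod u) ((fixS S f).erase v) := by
            rw [Finset.disjoint_left]
            intro a ha hb
            exact (hcross a ha a hb).1 rfl
          have := hB v hv _ hCS hCcl (Finset.mem_union_left _ hvu)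
          rw [Finset.card_union_of_disjoint hdis, Finset.card_erase_of_mem hvF] at this
          have h0 : 0 < (fixS S f).card := Finset.card_pos.2 ⟨v, hvF⟩
          have := hmin u huS
          omega
      obtain ⟨k0, hk0, -⟩ := pm_orbits hf.1
      exact ⟨f, hf.1, by omega⟩
    · push Not at hcrit
      obtain ⟨v, hv, hno⟩ := hcrit
      have hsub : S.erase v ⊆ S := Finset.erase_subset _ _
      have hce : (S.erase v).card = n := by rw [Finset.card_erase_of_mem hv]; omega
      obtain ⟨f, hf, hfc⟩ := ih (S.erase v) hce
        (fun a ha b hb c hc => hα a (hsub ha) b (hsub hb) c (hsub hc)) (hB.subset hsub)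
      have hfv : f v = v := hf.2.2 v (by simp)
      have hfS : IsPM G S f := ⟨hf.1, hf.2.1, fun x hx => hf.2.2 x (fun h => hx (hsub h))⟩
      have hfx : (fixS S f).card = (fixS (S.erase v) f).card + 1 := by
        have : fixS S f = insert v (fixS (S.erase v) f) := by
          ext x
          simp only [mem_fixS, Finset.mem_insert, Finset.mem_erase]
          grind
        rw [this, Finset.card_insert_of_notMem]
        simp [mem_fixS]
      have hnopt : ¬IsOpt G S f := fun h => hno f h hfv
      have : ∃ g, IsPM G S g ∧ (fixS S g).card < (fixS S f).card := by
        by_contra hcon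
        push Not at hcon
        exact hnopt ⟨hfS, hcon⟩
      obtain ⟨g, hg, hlt⟩ := this
      obtain ⟨k1, hk1, -⟩ := pm_orbits hg
      obtain ⟨k2, hk2, -⟩ := pm_orbits hf
      exact ⟨g, hg, by omega⟩

theorem base_col {V : Type*} [Finite V] {G : SimpleGraph V} {k : ℕ} {S : Finset V}
    (hα : ∀ a ∈ S, ∀ b ∈ S, ∀ c ∈ S, a ≠ b → a ≠ c → b ≠ c →
      G.Adj a b ∨ G.Adj a c ∨ G.Adj b c) (hB : LocBound G S k) : ColOn G S k := by
  obtain ⟨f, hf, hc⟩ := base_pm k S.card S rfl hα hB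
  obtain ⟨k0, hk0, hcol⟩ := pm_orbits hf
  exact hcol.mono (by omega)

theorem LocBound.mono_graph {V : Type*} {G G' : SimpleGraph V} {S : Finset V} {k : ℕ}
    (h : LocBound G S k) (hs : G' ≤ G) : LocBound G' S k := by
  intro v hv C hC hcl hvC
  have := h v hv C hC (hcl.mono hs) hvC
  have h2 : {y ∈ (S : Set V) | G'.Adj v y}.ncard ≤ {y ∈ (S : Set V) | G.Adj v y}.ncard := by
    apply Set.ncard_le_ncard
    · intro y hy
      exact ⟨hy.1, hs hy.2⟩
    · exact S.finite_toSet.subset (fun y hy => hy.1)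
  omega

/-- Removing a good stable set. -/
theorem remove_step {V : Type*} [DecidableEq V] {G : SimpleGraph V} {S T : Finset V} {k : ℕ}
    (hTS : T ⊆ S) (hT : T.Nonempty) (hst : ∀ a ∈ T, ∀ b ∈ T, ¬G.Adj a b)
    (h : ∀ x ∈ S, x ∉ T → (∃ t1 ∈ T, ∃ t2 ∈ T, t1 ≠ t2 ∧ G.Adj x t1 ∧ G.Adj x t2) ∨
      ∃ t ∈ T, G.Adj x t ∧ ∀ y ∈ S, y ∉ T → G.Adj x y → G.Adj t y)
    (hB : LocBound G S k) :
    ∃ k', k = k' + 1 ∧ LocBound G (S \ T) k' ∧ (ColOn G (S \ T) k' → ColOn G S k) := by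
  obtain ⟨t0, ht0⟩ := hT
  have hk : 1 ≤ k := by
    have := hB t0 (hTS ht0) {t0} (by simpa using hTS ht0) (by simp) (by simp)
    simp at this
    omega
  obtain ⟨k', rfl⟩ : ∃ k', k = k' + 1 := ⟨k - 1, by omega⟩
  refine ⟨k', rfl, ?_, ?_⟩
  · intro x hx C hC hcl hxC
    rw [Finset.mem_sdiff] at hx
    have hfin : ∀ x, {y ∈ (S : Set V) | G.Adj x y}.Finite := fun x =>
      S.finite_toSet.subset (fun y hy => hy.1)
    have hfin' : {y ∈ ((S \ T : Finset V) : Set V) | G.Adj x y}.Finite :=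
      (S \ T).finite_toSet.subset (fun y hy => hy.1)
    rcases h x hx.1 hx.2 with ⟨t1, h1, t2, h2, hne, ha1, ha2⟩ | ⟨t, ht, hat, hdom⟩
    · have hb := hB x hx.1 C (hC.trans Finset.sdiff_subset) hcl hxC
      have hsub : insert t1 (insert t2 {y ∈ ((S \ T : Finset V) : Set V) | G.Adj x y}) ⊆
          {y ∈ (S : Set V) | G.Adj x y} := by
        intro y hy
        rcases hy with rfl | rfl | hy
        · exact ⟨hTS h1, ha1⟩
        · exact ⟨hTS h2, ha2⟩
        · exact ⟨(Finset.mem_sdiff.1 hy.1).1, hy.2⟩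
      have hc := Set.ncard_le_ncard hsub (hfin x)
      rw [Set.ncard_insert_of_notMem _ (hfin'.insert _), Set.ncard_insert_of_notMem _ hfin'] at hc
      · omega
      · intro hy
        exact (Finset.mem_sdiff.1 hy.1).2 h2
      · rintro (hy | hy)
        · exact hne hy
        · exact (Finset.mem_sdiff.1 hy.1).2 h1
    · have htC : t ∉ C := fun hc => (Finset.mem_sdiff.1 (hC hc)).2 ht
      have hcl' : G.IsClique ((insert t C : Finset V) : Set V) := by
        rw [Finset.coe_insert]
        apply hcl.insert
        intro y hy _
        by_cases hxy : x = y
        · exact hxy ▸ hat.symm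
        · have := Finset.mem_sdiff.1 (hC hy)
          exact hdom y this.1 this.2 (hcl hxC hy hxy)
      have hb := hB x hx.1 (insert t C)
        (Finset.insert_subset (hTS ht) (hC.trans Finset.sdiff_subset)) hcl'
        (Finset.mem_insert_of_mem hxC)
      rw [Finset.card_insert_of_notMem htC] at hb
      have hsub : insert t {y ∈ ((S \ T : Finset V) : Set V) | G.Adj x y} ⊆
          {y ∈ (S : Set V) | G.Adj x y} := by
        intro y hy
        rcases hy with rfl | hy
        · exact ⟨hTS ht, hat⟩
        · exact ⟨(Finset.mem_sdiff.1 hy.1).1, hy.2⟩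
      have hc := Set.ncard_le_ncard hsub (hfin x)
      rw [Set.ncard_insert_of_notMem _ hfin'] at hc
      · omega
      · intro hy
        exact (Finset.mem_sdiff.1 hy.1).2 ht
  · rintro ⟨c, hc1, hc2⟩
    refine ⟨fun x => if x ∈ T then k' else c x, ?_, ?_⟩
    · intro x hx
      by_cases hxT : x ∈ T
      · simp [hxT]
      · simp only [hxT, if_false]
        have := hc1 x (Finset.mem_sdiff.2 ⟨hx, hxT⟩)
        omega
    · intro x hx y hy hxy
      by_cases hxT : x ∈ T <;> by_cases hyT : y ∈ T
      · exact absurd hxy (hst x hxT y hyT)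
      · simp only [hxT, hyT, if_true, if_false]
        have := hc1 y (Finset.mem_sdiff.2 ⟨hy, hyT⟩)
        omega
      · simp only [hxT, hyT, if_true, if_false]
        have := hc1 x (Finset.mem_sdiff.2 ⟨hx, hxT⟩)
        omega
      · simp only [hxT, hyT, if_false]
        exact hc2 x (Finset.mem_sdiff.2 ⟨hx, hxT⟩) y (Finset.mem_sdiff.2 ⟨hy, hyT⟩) hxy

/-- König: a large matching of nonedges between two cliques. -/
theorem konig_pair {V : Type*} [DecidableEq V] {G : SimpleGraph V} {A B X : Finset V}
    (hA : G.IsClique (A : Set V)) (hB : G.IsClique (B : Set V)) (hAB : Disjoint A B)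
    (hBX : B.card ≤ X.card)
    (hX : ∀ Y ⊆ A ∪ B, G.IsClique (Y : Set V) → Y.card ≤ X.card) :
    ∃ A1 ⊆ A, ∃ g : V → V, Set.InjOn g (A1 : Set V) ∧ (∀ a ∈ A1, g a ∈ B ∧ ¬G.Adj a (g a)) ∧
      A.card + B.card ≤ A1.card + X.card := by
  classical
  obtain ⟨d, hd⟩ : ∃ d, X.card = B.card + d := ⟨X.card - B.card, by omega⟩
  let t : A → Finset (V ⊕ Fin d) := fun a =>
    (B.filter (fun b => ¬G.Adj a b)).disjSum Finset.univ
  have hall : ∀ s : Finset A, s.card ≤ (s.biUnion t).card := by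
    intro s
    rcases s.eq_empty_or_nonempty with rfl | ⟨a0, ha0⟩
    · simp
    let N := B.filter (fun b => ∃ a ∈ s, ¬G.Adj a b)
    have hNB : N ⊆ B := Finset.filter_subset _ _
    have hsub : N.disjSum Finset.univ ⊆ s.biUnion t := by
      intro m hm
      rw [Finset.mem_biUnion]
      rcases m with b | i
      · rw [Finset.inl_mem_disjSum] at hm
        obtain ⟨hb, a, ha, hn⟩ := Finset.mem_filter.1 hm
        exact ⟨a, ha, Finset.inl_mem_disjSum.2 (Finset.mem_filter.2 ⟨hb, hn⟩)⟩
      · exact ⟨a0, ha0, Finset.inr_mem_disjSum.2 (Finset.mem_univ _)⟩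
    have hc := Finset.card_le_card hsub
    rw [Finset.card_disjSum, Finset.card_univ, Fintype.card_fin] at hc
    let s' : Finset V := s.map (Function.Embedding.subtype _)
    have hs'A : s' ⊆ A := by
      intro x hx
      simp only [s', Finset.mem_map] at hx
      obtain ⟨a, -, rfl⟩ := hx
      exact a.2
    have hcl : G.IsClique ((s' ∪ (B \ N) : Finset V) : Set V) := by
      have cross : ∀ x ∈ s', ∀ y ∈ B \ N, G.Adj x y := by
        intro x hx y hy
        simp only [s', Finset.mem_map] at hx
        obtain ⟨a, ha, rfl⟩ := hx
        rw [Finset.mem_sdiff] at hy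
        by_contra hn
        exact hy.2 (Finset.mem_filter.2 ⟨hy.1, a, ha, hn⟩)
      intro x hx y hy hxy
      rw [Finset.mem_coe, Finset.mem_union] at hx hy
      rcases hx with hx | hx <;> rcases hy with hy | hy
      · exact hA (hs'A hx) (hs'A hy) hxy
      · exact cross x hx y hy
      · exact (cross y hy x hx).symm
      · exact hB (Finset.mem_sdiff.1 hx).1 (Finset.mem_sdiff.1 hy).1 hxy
    have hle := hX _ (Finset.union_subset_union hs'A Finset.sdiff_subset) hcl
    rw [Finset.card_union_of_disjoint (hAB.mono hs'A Finset.sdiff_subset),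
      Finset.card_sdiff_of_subset hNB] at hle
    have hs'c : s'.card = s.card := Finset.card_map _
    have : N.card ≤ B.card := Finset.card_filter_le _ _
    omega
  obtain ⟨F, hFinj, hF⟩ := (Finset.all_card_le_biUnion_card_iff_exists_injective t).1 hall
  let F' : V → V ⊕ Fin d := fun x => if h : x ∈ A then F ⟨x, h⟩ else Sum.inl x
  have hF'inj : Set.InjOn F' (A : Set V) := by
    intro x hx y hy hxy
    rw [Finset.mem_coe] at hx hy
    simp only [F', hx, hy, dite_true] at hxy
    simpa using hFinj hxy
  have hF' : ∀ x ∈ A, F' x ∈ (B.filter (fun b => ¬G.Adj x b)).disjSum Finset.univ := by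
    intro x hx
    simp only [F', hx, dite_true]
    exact hF ⟨x, hx⟩
  let A1 := A.filter (fun x => (F' x).isLeft)
  let A2 := A.filter (fun x => ¬(F' x).isLeft)
  have hcardA : A1.card + A2.card = A.card := Finset.card_filter_add_card_filter_not _
  have hA2 : A2.card ≤ d := by
    have : (A2.image F') ⊆ (∅ : Finset V).disjSum (Finset.univ : Finset (Fin d)) := by
      intro m hm
      obtain ⟨x, hx, rfl⟩ := Finset.mem_image.1 hm
      have := (Finset.mem_filter.1 hx).2
      rcases hh : F' x with b | i
      · simp [hh] at this
      · simp
    have hc := Finset.card_le_card this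
    rw [Finset.card_image_of_injOn (hF'inj.mono (by
      intro x hx; exact (Finset.mem_filter.1 hx).1))] at hc
    simpa using hc
  refine ⟨A1, Finset.filter_subset _ _, fun x => (F' x).elim id (fun _ => x), ?_, ?_, by omega⟩
  · intro x hx y hy hxy
    have hx' := Finset.mem_filter.1 hx
    have hy' := Finset.mem_filter.1 hy
    apply hF'inj hx'.1 hy'.1
    rcases e1 : F' x with b | i <;> rcases e2 : F' y with b' | i'
    · simp [e1, e2] at hxy
      rw [hxy]
    · simp [e2] at hy'
    · simp [e1] at hx'
    · simp [e1] at hx'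
  · intro x hx
    have hx' := Finset.mem_filter.1 hx
    have := hF' x hx'.1
    rcases e1 : F' x with b | i
    · rw [e1, Finset.inl_mem_disjSum, Finset.mem_filter] at this
      simpa [e1] using this
    · simp [e1] at hx'

/-- Keep, between `A` and `B`, only the edges inside `X`. -/
def redG {V : Type*} (G : SimpleGraph V) (A B X : Finset V) : SimpleGraph V where
  Adj x y := G.Adj x y ∧ ((x ∈ A ∧ y ∈ B) ∨ (x ∈ B ∧ y ∈ A) → x ∈ X ∧ y ∈ X)
  symm := ⟨fun x y h => ⟨h.1.symm, fun h' => (h.2 (by tauto)).symm⟩⟩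
  loopless := ⟨fun x h => G.loopless.irrefl x h.1⟩

theorem exists_inj_of_card {V : Type*} (s : Finset V) (t : Finset ℕ) (h : s.card ≤ t.card) :
    ∃ f : V → ℕ, (∀ x ∈ s, f x ∈ t) ∧ Set.InjOn f (s : Set V) := by
  classical
  obtain ⟨e⟩ : Nonempty (s ↪ t) := by
    apply Function.Embedding.nonempty_of_card_le
    simpa using h
  refine ⟨fun x => if hx : x ∈ s then (e ⟨x, hx⟩ : ℕ) else 0, ?_, ?_⟩
  · intro x hx
    simp [hx]
  · intro x hx y hy hxy
    rw [Finset.mem_coe] at hx hy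
    simp only [hx, hy, dite_true] at hxy
    simpa using e.injective (Subtype.ext hxy)

theorem homog_reduce {V : Type*} [DecidableEq V] {G : SimpleGraph V} {S A B : Finset V}
    (hAS : A ⊆ S) (hBS : B ⊆ S)
    (hA : G.IsClique (A : Set V)) (hB : G.IsClique (B : Set V)) (hAB : Disjoint A B)
    (hom : ∀ z ∈ S, z ∉ A → z ∉ B → ((∀ a ∈ A, G.Adj z a) ∨ ∀ a ∈ A, ¬G.Adj z a) ∧
      ((∀ b ∈ B, G.Adj z b) ∨ ∀ b ∈ B, ¬G.Adj z b)) :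
    ∃ X ⊆ A ∪ B, G.IsClique (X : Set V) ∧ A.card ≤ X.card ∧
      ∀ k, ColOn (redG G A B X) S k → ColOn G S k := by
  classical
  let P := (A ∪ B).powerset.filter (fun Y : Finset V => G.IsClique (Y : Set V))
  have mP : ∀ Y, Y ∈ P ↔ Y ⊆ A ∪ B ∧ G.IsClique (Y : Set V) := fun Y => by
    simp only [P, Finset.mem_filter, Finset.mem_powerset]
  have hPA : A ∈ P := (mP A).2 ⟨Finset.subset_union_left, hA⟩
  have hPB : B ∈ P := (mP B).2 ⟨Finset.subset_union_right, hB⟩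
  obtain ⟨X, hXP, hXmax⟩ := Finset.exists_max_image P Finset.card ⟨A, hPA⟩
  obtain ⟨hXAB, hXcl⟩ := (mP X).1 hXP
  refine ⟨X, hXAB, hXcl, hXmax A hPA, ?_⟩
  rintro k ⟨c, hck, hc⟩
  have hdisj : ∀ x, x ∈ A → x ∉ B := fun x h h' => Finset.disjoint_left.1 hAB h h'
  obtain ⟨A1, hA1, g, hginj, hg, hcard⟩ := konig_pair hA hB hAB (hXmax B hPB)
    (fun Y hY hcl => hXmax Y ((mP Y).2 ⟨hY, hcl⟩))
  have hcA : Set.InjOn c (A : Set V) := by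
    intro x hx y hy hxy
    rw [Finset.mem_coe] at hx hy
    by_contra hne
    refine hc x (hAS hx) y (hAS hy) ⟨hA hx hy hne, fun h => ?_⟩ hxy
    exact absurd h (by have := hdisj x hx; have := hdisj y hy; tauto)
  have hcB : Set.InjOn c (B : Set V) := by
    intro x hx y hy hxy
    rw [Finset.mem_coe] at hx hy
    by_contra hne
    refine hc x (hBS hx) y (hBS hy) ⟨hB hx hy hne, fun h => ?_⟩ hxy
    exact absurd h (by have := hdisj x; have := hdisj y; tauto)
  have hcX : Set.InjOn c (X : Set V) := by
    intro x hx y hy hxy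
    by_contra hne
    exact hc x (Finset.union_subset hAS hBS (hXAB hx)) y (Finset.union_subset hAS hBS (hXAB hy))
      ⟨hXcl hx hy hne, fun _ => ⟨hx, hy⟩⟩ hxy
  let CA := A.image c
  let CB := B.image c
  let I := CA ∩ CB
  have hCA : CA.card = A.card := Finset.card_image_of_injOn hcA
  have hCB : CB.card = B.card := Finset.card_image_of_injOn hcB
  have hI : I.card ≤ A1.card := by
    have h1 : X.image c ⊆ CA ∪ CB := by
      rw [← Finset.image_union]
      exact Finset.image_subset_image hXAB
    have h2 := Finset.card_le_card h1
    rw [Finset.card_image_of_injOn hcX] at h2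
    have h3 := Finset.card_union_add_card_inter CA CB
    simp only [I]
    omega
  obtain ⟨A2, hA2, hA2c⟩ := Finset.exists_subset_card_eq hI
  have hA2A : A2 ⊆ A := hA2.trans hA1
  have hg2 : Set.InjOn g (A2 : Set V) := hginj.mono (by exact_mod_cast hA2)
  let B2 := A2.image g
  have hB2c : B2.card = A2.card := Finset.card_image_of_injOn hg2
  have hB2B : B2 ⊆ B := by
    intro y hy
    obtain ⟨a, ha, rfl⟩ := Finset.mem_image.1 hy
    exact (hg a (hA2 ha)).1
  have hIA : I ⊆ CA := Finset.inter_subset_left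
  have hIB : I ⊆ CB := Finset.inter_subset_right
  obtain ⟨f1, hf1, hf1i⟩ := exists_inj_of_card A2 I hA2c.le
  obtain ⟨f2, hf2, hf2i⟩ := exists_inj_of_card (A \ A2) (CA \ I) (by
    rw [Finset.card_sdiff_of_subset hA2A, Finset.card_sdiff_of_subset hIA]
    omega)
  obtain ⟨f3, hf3, hf3i⟩ := exists_inj_of_card (B \ B2) (CB \ I) (by
    rw [Finset.card_sdiff_of_subset hB2B, Finset.card_sdiff_of_subset hIB]
    omega)
  -- inverse of g on B2
  obtain ⟨gi, hgi⟩ : ∃ gi : V → V, ∀ b ∈ B2, gi b ∈ A2 ∧ g (gi b) = b := by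
    have : ∀ b, ∃ a, b ∈ B2 → a ∈ A2 ∧ g a = b := by
      intro b
      by_cases hb : b ∈ B2
      · obtain ⟨a, ha⟩ := Finset.mem_image.1 hb
        exact ⟨a, fun _ => ha⟩
      · exact ⟨b, fun h => absurd h hb⟩
    choose gi hgi using this
    exact ⟨gi, hgi⟩
  let c' : V → ℕ := fun x => if x ∈ A2 then f1 x else if x ∈ A then f2 x else
    if x ∈ B2 then f1 (gi x) else if x ∈ B then f3 x else c x
  have v1 : ∀ x ∈ A2, c' x = f1 x := fun x hx => by simp [c', hx]
  have v2 : ∀ x ∈ A, x ∉ A2 → c' x = f2 x := fun x hx hx2 => by simp [c', hx, hx2]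
  have v3 : ∀ x ∈ B2, c' x = f1 (gi x) := fun x hx => by
    have h1 : x ∉ A := fun h => hdisj x h (hB2B hx)
    have h2 : x ∉ A2 := fun h => h1 (hA2A h)
    simp [c', hx, h1, h2]
  have v4 : ∀ x ∈ B, x ∉ B2 → c' x = f3 x := fun x hx hx2 => by
    have h1 : x ∉ A := fun h => hdisj x h hx
    have h2 : x ∉ A2 := fun h => h1 (hA2A h)
    simp [c', hx, h1, h2, hx2]
  have v5 : ∀ x, x ∉ A → x ∉ B → c' x = c x := fun x h1 h3 => by
    have h2 : x ∉ A2 := fun h => h1 (hA2A h)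
    have h4 : x ∉ B2 := fun h => h3 (hB2B h)
    simp [c', h1, h2, h3, h4]
  have w1 : ∀ x ∈ A, c' x ∈ CA ∧ (x ∈ A2 ↔ c' x ∈ I) := by
    intro x hx
    by_cases h : x ∈ A2
    · have := hf1 x h
      rw [v1 x h]
      exact ⟨(Finset.mem_inter.1 this).1, by tauto⟩
    · have := Finset.mem_sdiff.1 (hf2 x (Finset.mem_sdiff.2 ⟨hx, h⟩))
      rw [v2 x hx h]
      exact ⟨this.1, by tauto⟩
  have w2 : ∀ x ∈ B, c' x ∈ CB ∧ (x ∈ B2 ↔ c' x ∈ I) := by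
    intro x hx
    by_cases h : x ∈ B2
    · have := hf1 _ (hgi x h).1
      rw [v3 x h]
      exact ⟨(Finset.mem_inter.1 this).2, by tauto⟩
    · have := Finset.mem_sdiff.1 (hf3 x (Finset.mem_sdiff.2 ⟨hx, h⟩))
      rw [v4 x hx h]
      exact ⟨this.1, by tauto⟩
  have iA : ∀ x ∈ A, ∀ y ∈ A, c' x = c' y → x = y := by
    intro x hx y hy hxy
    by_cases h : x ∈ A2
    · have h' : y ∈ A2 := by rw [(w1 y hy).2, ← hxy, ← (w1 x hx).2]; exact h
      rw [v1 x h, v1 y h'] at hxy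
      exact hf1i h h' hxy
    · have h' : y ∉ A2 := by rw [(w1 y hy).2, ← hxy, ← (w1 x hx).2]; exact h
      rw [v2 x hx h, v2 y hy h'] at hxy
      exact hf2i (by simp [hx, h]) (by simp [hy, h']) hxy
  have iB : ∀ x ∈ B, ∀ y ∈ B, c' x = c' y → x = y := by
    intro x hx y hy hxy
    by_cases h : x ∈ B2
    · have h' : y ∈ B2 := by rw [(w2 y hy).2, ← hxy, ← (w2 x hx).2]; exact h
      rw [v3 x h, v3 y h'] at hxy
      have := hf1i (hgi x h).1 (hgi y h').1 hxy
      rw [← (hgi x h).2, ← (hgi y h').2, this]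
    · have h' : y ∉ B2 := by rw [(w2 y hy).2, ← hxy, ← (w2 x hx).2]; exact h
      rw [v4 x hx h, v4 y hy h'] at hxy
      exact hf3i (by simp [hx, h]) (by simp [hy, h']) hxy
  have iAB : ∀ x ∈ A, ∀ y ∈ B, c' x = c' y → ¬G.Adj x y := by
    intro x hx y hy hxy
    have hI : c' x ∈ I := Finset.mem_inter.2 ⟨(w1 x hx).1, hxy ▸ (w2 y hy).1⟩
    have h : x ∈ A2 := (w1 x hx).2.2 hI
    have h' : y ∈ B2 := (w2 y hy).2.2 (hxy ▸ hI)
    rw [v1 x h, v3 y h'] at hxy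
    have := hf1i h (hgi y h').1 hxy
    have h2 := (hg x (hA2 h)).2
    rwa [this, (hgi y h').2, ← this] at h2
  have oA : ∀ x ∈ A, ∀ y ∈ S, y ∉ A → y ∉ B → G.Adj x y → c' x ≠ c y := by
    intro x hx y hy h1 h2 hxy heq
    obtain ⟨a, ha, hac⟩ := Finset.mem_image.1 (w1 x hx).1
    rcases (hom y hy h1 h2).1 with h | h
    · exact hc a (hAS ha) y hy ⟨(h a ha).symm, fun h => absurd h (by tauto)⟩ (hac.trans heq)
    · exact h x hx hxy.symm
  have oB : ∀ x ∈ B, ∀ y ∈ S, y ∉ A → y ∉ B → G.Adj x y → c' x ≠ c y := by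
    intro x hx y hy h1 h2 hxy heq
    obtain ⟨a, ha, hac⟩ := Finset.mem_image.1 (w2 x hx).1
    rcases (hom y hy h1 h2).2 with h | h
    · exact hc a (hBS ha) y hy ⟨(h a ha).symm, fun h => absurd h (by tauto)⟩ (hac.trans heq)
    · exact h x hx hxy.symm
  refine ⟨c', ?_, ?_⟩
  · intro x hx
    by_cases h1 : x ∈ A
    · obtain ⟨a, ha, hac⟩ := Finset.mem_image.1 (w1 x h1).1
      rw [← hac]
      exact hck a (hAS ha)
    by_cases h2 : x ∈ B
    · obtain ⟨a, ha, hac⟩ := Finset.mem_image.1 (w2 x h2).1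
      rw [← hac]
      exact hck a (hBS ha)
    rw [v5 x h1 h2]
    exact hck x hx
  · intro x hx y hy hxy heq
    by_cases x1 : x ∈ A
    · by_cases y1 : y ∈ A
      · exact hxy.ne (iA x x1 y y1 heq)
      by_cases y2 : y ∈ B
      · exact iAB x x1 y y2 heq hxy
      exact oA x x1 y hy y1 y2 hxy (by rw [heq, v5 y y1 y2])
    by_cases x2 : x ∈ B
    · by_cases y1 : y ∈ A
      · exact iAB y y1 x x2 heq.symm hxy.symm
      by_cases y2 : y ∈ B
      · exact hxy.ne (iB x x2 y y2 heq)
      exact oB x x2 y hy y1 y2 hxy (by rw [heq, v5 y y1 y2])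
    by_cases y1 : y ∈ A
    · exact oA y y1 x hx x1 x2 hxy.symm (by rw [← heq, v5 x x1 x2])
    by_cases y2 : y ∈ B
    · exact oB y y2 x hx x1 x2 hxy.symm (by rw [← heq, v5 x x1 x2])
    rw [v5 x x1 x2, v5 y y1 y2] at heq
    exact hc x hx y hy ⟨hxy, fun h => absurd h (by tauto)⟩ heq

/-- Weak form of thickening, closed under taking subgraphs between matched cliques. -/
def WeakThick {V W : Type*} (H : SimpleGraph W) (M : Set (Sym2 W)) (G : SimpleGraph V)
    (p : V → W) : Prop :=
  (∀ x y, x ≠ y → p x = p y → G.Adj x y) ∧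
  (∀ x y, H.Adj (p x) (p y) → s(p x, p y) ∉ M → G.Adj x y) ∧
  (∀ x y, p x ≠ p y → G.Adj x y → H.Adj (p x) (p y))

theorem ap_key {W : Type*} [DecidableEq W] {H : SimpleGraph W} {M : Set (Sym2 W)}
    (hM : ChangeableMatching H M)
    {u v w z : W} (huv : u ≠ v) (huw : u ≠ w) (hvw : v ≠ w)
    (h1 : ¬H.Adj u v ∨ s(u, v) ∈ M) (h2 : ¬H.Adj u w ∨ s(u, w) ∈ M)
    (h3 : ¬H.Adj v w ∨ s(v, w) ∈ M) (hzu : z ≠ u) (hzv : z ≠ v) (hzw : z ≠ w) :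
    ∃ t ∈ ({u, v, w} : Finset W), ¬H.Adj z t ∧
      ∀ t' ∈ ({u, v, w} : Finset W), t' ≠ t → H.Adj z t' ∧ s(z, t') ∉ M := by
  obtain ⟨-, -, hch⟩ := hM
  have hzT : z ∉ ({u, v, w} : Finset W) := by simp [hzu, hzv, hzw]
  have hcard : ({u, v, w} : Finset W).card = 3 := by
    rw [Finset.card_eq_three]
    exact ⟨u, v, w, huv, huw, hvw, rfl⟩
  have key : ∀ M' : Set (Sym2 W), (s(u, v) ∈ M → s(u, v) ∈ M') → (s(u, w) ∈ M → s(u, w) ∈ M') →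
      (s(v, w) ∈ M → s(v, w) ∈ M') → IsTriad (H.deleteEdges M') ({u, v, w} : Finset W) := by
    intro M' i1 i2 i3
    refine ⟨hcard, ?_⟩
    have n1 : ¬(H.deleteEdges M').Adj u v := by
      rw [SimpleGraph.deleteEdges_adj]; tauto
    have n2 : ¬(H.deleteEdges M').Adj u w := by
      rw [SimpleGraph.deleteEdges_adj]; tauto
    have n3 : ¬(H.deleteEdges M').Adj v w := by
      rw [SimpleGraph.deleteEdges_adj]; tauto
    intro a ha b hb hab
    simp only [Finset.mem_insert, Finset.mem_singleton] at ha hb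
    rcases ha with rfl | rfl | rfl <;> rcases hb with rfl | rfl | rfl <;>
      first
      | exact absurd rfl hab
      | assumption
      | (intro h; exact absurd h.symm (by assumption))
  obtain ⟨t, htT, hnt, hall⟩ := hch M (le_refl _) _ (key M id id id) z hzT
  let M1 : Set (Sym2 W) := {e ∈ M | e = s(u, v) ∨ e = s(u, w) ∨ e = s(v, w)}
  obtain ⟨t2, ht2T, hnt2, -⟩ := hch M1 (fun e he => he.1) _
    (key M1 (fun h => ⟨h, by tauto⟩) (fun h => ⟨h, by tauto⟩) (fun h => ⟨h, by tauto⟩)) z hzT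
  have hz1 : ∀ a, s(z, a) ∉ M1 := by
    rintro a ⟨-, h⟩
    simp only [Sym2.eq_iff] at h
    tauto
  have hnt2' : ¬H.Adj z t2 := fun h => hnt2 (by
    rw [SimpleGraph.deleteEdges_adj]; exact ⟨h, hz1 _⟩)
  have heq : t2 = t := by
    by_contra hne
    have := hall t2 ht2T hne
    rw [SimpleGraph.deleteEdges_adj] at this
    exact hnt2' this.1
  subst heq
  refine ⟨t2, ht2T, hnt2', fun t' ht' hne => ?_⟩
  have := hall t' ht' hne
  rwa [SimpleGraph.deleteEdges_adj] at this

/-- Packaged consequences of `ap_key` for three vertices of a weak thickening. -/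
theorem ap_thick {V W : Type*} {H : SimpleGraph W} {M : Set (Sym2 W)}
    (hM : ChangeableMatching H M) {G : SimpleGraph V} {p : V → W} (hG : WeakThick H M G p)
    {a b c : V} (hab : p a ≠ p b) (hac : p a ≠ p c) (hbc : p b ≠ p c)
    (h1 : ¬H.Adj (p a) (p b) ∨ s(p a, p b) ∈ M) (h2 : ¬H.Adj (p a) (p c) ∨ s(p a, p c) ∈ M)
    (h3 : ¬H.Adj (p b) (p c) ∨ s(p b, p c) ∈ M)
    {y : V} (ya : p y ≠ p a) (yb : p y ≠ p b) (yc : p y ≠ p c) :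
    ((G.Adj y a ∧ G.Adj y b) ∨ (G.Adj y a ∧ G.Adj y c) ∨ (G.Adj y b ∧ G.Adj y c)) ∧
    (∀ x t, p x = p t → (p t = p a ∨ p t = p b ∨ p t = p c) → G.Adj x y → G.Adj t y) := by
  classical
  obtain ⟨g1, g2, g3⟩ := hG
  obtain ⟨t, ht, hnt, hall⟩ := ap_key hM hab hac hbc h1 h2 h3 ya yb yc
  have A : ∀ t', p t' ∈ ({p a, p b, p c} : Finset W) → p t' ≠ t → G.Adj y t' := by
    intro t' ht' hne
    have := hall _ ht' hne
    exact g2 _ _ this.1 this.2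
  constructor
  · have ha : p a ≠ t → G.Adj y a := A a (by simp)
    have hb : p b ≠ t → G.Adj y b := A b (by simp)
    have hc : p c ≠ t → G.Adj y c := A c (by simp)
    by_cases e1 : p a = t
    · have e2 : p b ≠ t := fun h => hab (e1.trans h.symm)
      have e3 : p c ≠ t := fun h => hac (e1.trans h.symm)
      tauto
    · by_cases e2 : p b = t
      · have e3 : p c ≠ t := fun h => hbc (e2.trans h.symm)
        tauto
      · tauto
  · intro x t' hxt ht' hxy
    have hne : p x ≠ p y := by
      rw [hxt]
      rcases ht' with h | h | h <;> rw [h]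
      · exact ya.symm
      · exact yb.symm
      · exact yc.symm
    have hadj := g3 x y hne hxy
    refine (A t' (by simpa using ht') ?_).symm
    rintro rfl
    exact hnt (hxt ▸ hadj.symm)

theorem pair_core {V W : Type*} [DecidableEq V] {H : SimpleGraph W} {M : Set (Sym2 W)}
    (hM : ChangeableMatching H M) {G : SimpleGraph V} {p : V → W} (hG : WeakThick H M G p)
    {S X : Finset V} {k : ℕ} {a b c : V} (haS : a ∈ S) (hbS : b ∈ S) (hcS : c ∈ S)
    (hab : p a ≠ p b) (hac : p a ≠ p c) (hbc : p b ≠ p c)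
    (h1 : s(p a, p b) ∈ M) (h2 : ¬H.Adj (p a) (p c)) (h3 : ¬H.Adj (p b) (p c))
    (hX : ∀ x ∈ S, ∀ y ∈ S, p x = p a → p y = p b → (G.Adj x y ↔ x ∈ X ∧ y ∈ X))
    (haX : a ∈ X) (hbX : b ∉ X) (hB : LocBound G S k)
    (ih : ∀ S' : Finset V, S'.card < S.card → ∀ k', LocBound G S' k' → ColOn G S' k') :
    ColOn G S k := by
  have hap := fun y ya yb yc => ap_thick hM hG (y := y) hab hac hbc (Or.inr h1) (Or.inl h2)
    (Or.inl h3) ya yb yc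
  have hnab : ¬G.Adj a b := fun h => hbX ((hX a haS b hbS rfl rfl).1 h).2
  obtain ⟨g1, g2, g3⟩ := hG
  have n2 : ∀ x y, p x = p a → p y = p c → ¬G.Adj x y := by
    intro x y hx hy h
    have := g3 x y (by rw [hx, hy]; exact hac) h
    rw [hx, hy] at this
    exact h2 this
  have n3 : ∀ x y, p x = p b → p y = p c → ¬G.Adj x y := by
    intro x y hx hy h
    have := g3 x y (by rw [hx, hy]; exact hbc) h
    rw [hx, hy] at this
    exact h3 this
  have nac := n2 a c rfl rfl
  have nbc := n3 b c rfl rfl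
  have eab : a ≠ b := fun h => hab (by rw [h])
  have eac : a ≠ c := fun h => hac (by rw [h])
  have ebc : b ≠ c := fun h => hbc (by rw [h])
  have hTS : ({a, b, c} : Finset V) ⊆ S := by
    intro x hx
    simp only [Finset.mem_insert, Finset.mem_singleton] at hx
    rcases hx with rfl | rfl | rfl <;> assumption
  obtain ⟨k', rfl, hB', hcol⟩ := remove_step (T := {a, b, c}) hTS ⟨a, by simp⟩ (by
    intro x hx y hy
    simp only [Finset.mem_insert, Finset.mem_singleton] at hx hy
    rcases hx with rfl | rfl | rfl <;> rcases hy with rfl | rfl | rfl <;>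
      first
      | exact G.loopless.irrefl _
      | assumption
      | (intro h; exact absurd h.symm (by assumption))) (by
    intro x hx hxT
    simp only [Finset.mem_insert, Finset.mem_singleton, not_or] at hxT ⊢
    obtain ⟨xa, xb, xc⟩ := hxT
    by_cases pa : p x = p a
    · right
      refine ⟨a, Or.inl rfl, g1 x a xa pa, ?_⟩
      rintro y hy ⟨ya, yb, yc⟩ hxy
      by_cases qa : p y = p a
      · exact g1 a y (Ne.symm ya) qa.symm
      by_cases qb : p y = p b
      · rw [hX a haS y hy rfl qb]
        exact ⟨haX, ((hX x hx y hy pa qb).1 hxy).2⟩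
      by_cases qc : p y = p c
      · exact absurd hxy (n2 x y pa qc)
      exact (hap y qa qb qc).2 x a pa (Or.inl rfl) hxy
    by_cases pb : p x = p b
    · by_cases hxX : x ∈ X
      · left
        exact ⟨a, Or.inl rfl, b, Or.inr (Or.inl rfl), eab,
          ((hX a haS x hx rfl pb).2 ⟨haX, hxX⟩).symm, g1 x b xb pb⟩
      · right
        refine ⟨b, Or.inr (Or.inl rfl), g1 x b xb pb, ?_⟩
        rintro y hy ⟨ya, yb, yc⟩ hxy
        by_cases qa : p y = p a
        · exact absurd ((hX y hy x hx qa pb).1 hxy.symm).2 hxX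
        by_cases qb : p y = p b
        · exact g1 b y (Ne.symm yb) qb.symm
        by_cases qc : p y = p c
        · exact absurd hxy (n3 x y pb qc)
        exact (hap y qa qb qc).2 x b pb (Or.inr (Or.inl rfl)) hxy
    by_cases pc : p x = p c
    · right
      refine ⟨c, Or.inr (Or.inr rfl), g1 x c xc pc, ?_⟩
      rintro y hy ⟨ya, yb, yc⟩ hxy
      by_cases qa : p y = p a
      · exact absurd hxy.symm (n2 y x qa pc)
      by_cases qb : p y = p b
      · exact absurd hxy.symm (n3 y x qb pc)
      by_cases qc : p y = p c
      · exact g1 c y (Ne.symm yc) qc.symm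
      exact (hap y qa qb qc).2 x c pc (Or.inr (Or.inr rfl)) hxy
    left
    rcases (hap x pa pb pc).1 with h | h | h
    · exact ⟨a, Or.inl rfl, b, Or.inr (Or.inl rfl), eab, h.1, h.2⟩
    · exact ⟨a, Or.inl rfl, c, Or.inr (Or.inr rfl), eac, h.1, h.2⟩
    · exact ⟨b, Or.inr (Or.inl rfl), c, Or.inr (Or.inr rfl), ebc, h.1, h.2⟩) hB
  refine hcol (ih _ ?_ _ hB')
  exact Finset.card_lt_card (Finset.sdiff_ssubset hTS ⟨a, by simp⟩)

theorem triad_case {V W : Type*} [DecidableEq V] {H : SimpleGraph W} {M : Set (Sym2 W)}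
    (hM : ChangeableMatching H M) {G : SimpleGraph V} {p : V → W} (hG : WeakThick H M G p)
    {S : Finset V} {k : ℕ} {a b c : V} (haS : a ∈ S) (hbS : b ∈ S) (hcS : c ∈ S)
    (hab : p a ≠ p b) (hac : p a ≠ p c) (hbc : p b ≠ p c)
    (h1 : ¬H.Adj (p a) (p b)) (h2 : ¬H.Adj (p a) (p c)) (h3 : ¬H.Adj (p b) (p c))
    (hB : LocBound G S k)
    (ih : ∀ S' : Finset V, S'.card < S.card → ∀ k', LocBound G S' k' → ColOn G S' k') :
    ColOn G S k := by
  have hap := fun y ya yb yc => ap_thick hM hG (y := y) hab hac hbc (Or.inl h1) (Or.inl h2)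
    (Or.inl h3) ya yb yc
  obtain ⟨g1, g2, g3⟩ := hG
  have nn : ∀ u v x y, p u ≠ p v → ¬H.Adj (p u) (p v) → p x = p u → p y = p v → ¬G.Adj x y := by
    intro u v x y hne hn hx hy h
    have := g3 x y (by rw [hx, hy]; exact hne) h
    rw [hx, hy] at this
    exact hn this
  have n1 := fun x y => nn a b x y hab h1
  have n2 := fun x y => nn a c x y hac h2
  have n3 := fun x y => nn b c x y hbc h3
  have nab := n1 a b rfl rfl
  have nac := n2 a c rfl rfl
  have nbc := n3 b c rfl rfl
  have eab : a ≠ b := fun h => hab (by rw [h])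
  have eac : a ≠ c := fun h => hac (by rw [h])
  have ebc : b ≠ c := fun h => hbc (by rw [h])
  have hTS : ({a, b, c} : Finset V) ⊆ S := by
    intro x hx
    simp only [Finset.mem_insert, Finset.mem_singleton] at hx
    rcases hx with rfl | rfl | rfl <;> assumption
  obtain ⟨k', rfl, hB', hcol⟩ := remove_step (T := {a, b, c}) hTS ⟨a, by simp⟩ (by
    intro x hx y hy
    simp only [Finset.mem_insert, Finset.mem_singleton] at hx hy
    rcases hx with rfl | rfl | rfl <;> rcases hy with rfl | rfl | rfl <;>
      first
      | exact G.loopless.irrefl _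
      | assumption
      | (intro h; exact absurd h.symm (by assumption))) (by
    intro x hx hxT
    simp only [Finset.mem_insert, Finset.mem_singleton, not_or] at hxT ⊢
    obtain ⟨xa, xb, xc⟩ := hxT
    by_cases pa : p x = p a
    · right
      refine ⟨a, Or.inl rfl, g1 x a xa pa, ?_⟩
      rintro y hy ⟨ya, yb, yc⟩ hxy
      by_cases qa : p y = p a
      · exact g1 a y (Ne.symm ya) qa.symm
      by_cases qb : p y = p b
      · exact absurd hxy (n1 x y pa qb)
      by_cases qc : p y = p c
      · exact absurd hxy (n2 x y pa qc)
      exact (hap y qa qb qc).2 x a pa (Or.inl rfl) hxy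
    by_cases pb : p x = p b
    · right
      refine ⟨b, Or.inr (Or.inl rfl), g1 x b xb pb, ?_⟩
      rintro y hy ⟨ya, yb, yc⟩ hxy
      by_cases qa : p y = p a
      · exact absurd hxy.symm (n1 y x qa pb)
      by_cases qb : p y = p b
      · exact g1 b y (Ne.symm yb) qb.symm
      by_cases qc : p y = p c
      · exact absurd hxy (n3 x y pb qc)
      exact (hap y qa qb qc).2 x b pb (Or.inr (Or.inl rfl)) hxy
    by_cases pc : p x = p c
    · right
      refine ⟨c, Or.inr (Or.inr rfl), g1 x c xc pc, ?_⟩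
      rintro y hy ⟨ya, yb, yc⟩ hxy
      by_cases qa : p y = p a
      · exact absurd hxy.symm (n2 y x qa pc)
      by_cases qb : p y = p b
      · exact absurd hxy.symm (n3 y x qb pc)
      by_cases qc : p y = p c
      · exact g1 c y (Ne.symm yc) qc.symm
      exact (hap y qa qb qc).2 x c pc (Or.inr (Or.inr rfl)) hxy
    left
    rcases (hap x pa pb pc).1 with h | h | h
    · exact ⟨a, Or.inl rfl, b, Or.inr (Or.inl rfl), eab, h.1, h.2⟩
    · exact ⟨a, Or.inl rfl, c, Or.inr (Or.inr rfl), eac, h.1, h.2⟩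
    · exact ⟨b, Or.inr (Or.inl rfl), c, Or.inr (Or.inr rfl), ebc, h.1, h.2⟩) hB
  refine hcol (ih _ ?_ _ hB')
  exact Finset.card_lt_card (Finset.sdiff_ssubset hTS ⟨a, by simp⟩)

theorem pair_case {V W : Type*} [DecidableEq V] {H : SimpleGraph W} {M : Set (Sym2 W)}
    (hM : ChangeableMatching H M) {G : SimpleGraph V} {p : V → W} (hG : WeakThick H M G p)
    {S : Finset V} {k : ℕ} {a b c : V} (haS : a ∈ S) (hbS : b ∈ S) (hcS : c ∈ S)
    (hab : p a ≠ p b) (hac : p a ≠ p c) (hbc : p b ≠ p c) (nab : ¬G.Adj a b)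
    (h1 : s(p a, p b) ∈ M) (h2 : ¬H.Adj (p a) (p c) ∨ s(p a, p c) ∈ M)
    (h3 : ¬H.Adj (p b) (p c) ∨ s(p b, p c) ∈ M)
    (hB : LocBound G S k)
    (ih : ∀ S' : Finset V, S'.card < S.card → ∀ G' : SimpleGraph V, WeakThick H M G' p →
      ∀ k', LocBound G' S' k' → ColOn G' S' k') :
    ColOn G S k := by
  classical
  have hmat := hM.2.1.2
  replace h2 : ¬H.Adj (p a) (p c) := by
    rcases h2 with h | h
    · exact h
    · exfalso
      refine hmat _ h1 _ h ?_ (p a) (by simp) (by simp)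
      intro he
      simp only [Sym2.eq_iff] at he
      tauto
  replace h3 : ¬H.Adj (p b) (p c) := by
    rcases h3 with h | h
    · exact h
    · exfalso
      refine hmat _ h1 _ h ?_ (p b) (by simp) (by simp)
      intro he
      simp only [Sym2.eq_iff] at he
      tauto
  have hG0 := hG
  obtain ⟨g1, g2, g3⟩ := hG
  let A := S.filter (fun x => p x = p a)
  let B := S.filter (fun x => p x = p b)
  have mA : ∀ x, x ∈ A ↔ x ∈ S ∧ p x = p a := fun x => by simp [A]
  have mB : ∀ x, x ∈ B ↔ x ∈ S ∧ p x = p b := fun x => by simp [B]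
  have hAcl : G.IsClique (A : Set V) := by
    intro x hx y hy hxy
    exact g1 x y hxy (((mA x).1 hx).2.trans ((mA y).1 hy).2.symm)
  have hBcl : G.IsClique (B : Set V) := by
    intro x hx y hy hxy
    exact g1 x y hxy (((mB x).1 hx).2.trans ((mB y).1 hy).2.symm)
  have hdis : Disjoint A B := by
    rw [Finset.disjoint_left]
    intro x hx hy
    exact hab (((mA x).1 hx).2.symm.trans ((mB x).1 hy).2)
  obtain ⟨X, hXAB, hXcl, hXA, hXcol⟩ := homog_reduce (Finset.filter_subset _ _ : A ⊆ S)
    (Finset.filter_subset _ _ : B ⊆ S) hAcl hBcl hdis (by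
    intro z hz hzA hzB
    have za : p z ≠ p a := fun h => hzA ((mA z).2 ⟨hz, h⟩)
    have zb : p z ≠ p b := fun h => hzB ((mB z).2 ⟨hz, h⟩)
    by_cases zc : p z = p c
    · constructor
      · right
        intro x hx h
        rw [mA] at hx
        have := g3 z x (by rw [hx.2]; exact za) h
        rw [hx.2, zc] at this
        exact h2 this.symm
      · right
        intro x hx h
        rw [mB] at hx
        have := g3 z x (by rw [hx.2]; exact zb) h
        rw [hx.2, zc] at this
        exact h3 this.symm
    · have hap := (ap_thick hM hG0 (y := z) hab hac hbc (Or.inr h1) (Or.inl h2)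
        (Or.inl h3) za zb zc).2
      constructor
      · by_cases hza : G.Adj z a
        · left
          intro x hx
          rw [mA] at hx
          exact (hap a x hx.2.symm (Or.inl hx.2) hza.symm).symm
        · right
          intro x hx h
          rw [mA] at hx
          exact hza (hap x a hx.2 (Or.inl rfl) h.symm).symm
      · by_cases hzb : G.Adj z b
        · left
          intro x hx
          rw [mB] at hx
          exact (hap b x hx.2.symm (Or.inr (Or.inl hx.2)) hzb.symm).symm
        · right
          intro x hx h
          rw [mB] at hx
          exact hzb (hap x b hx.2 (Or.inr (Or.inl rfl)) h.symm).symm)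
  apply hXcol
  have hle : redG G A B X ≤ G := fun x y h => h.1
  have hG' : WeakThick H M (redG G A B X) p := by
    refine ⟨?_, ?_, ?_⟩
    · intro x y hxy hp
      refine ⟨g1 x y hxy hp, ?_⟩
      rintro (⟨hx, hy⟩ | ⟨hx, hy⟩)
      · rw [mA] at hx
        rw [mB] at hy
        exact absurd (hx.2.symm.trans (hp.trans hy.2)) hab
      · rw [mB] at hx
        rw [mA] at hy
        exact absurd (hx.2.symm.trans (hp.trans hy.2)) hab.symm
    · intro x y hxy hp
      refine ⟨g2 x y hxy hp, ?_⟩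
      rintro (⟨hx, hy⟩ | ⟨hx, hy⟩)
      · rw [mA] at hx
        rw [mB] at hy
        rw [hx.2, hy.2] at hp
        exact absurd h1 hp
      · rw [mB] at hx
        rw [mA] at hy
        rw [hx.2, hy.2, Sym2.eq_swap] at hp
        exact absurd h1 hp
    · intro x y hxy h
      exact g3 x y hxy h.1
  have hB' := hB.mono_graph hle
  have ih' : ∀ S' : Finset V, S'.card < S.card → ∀ k', LocBound (redG G A B X) S' k' →
      ColOn (redG G A B X) S' k' := fun S' h k' hb => ih S' h _ hG' k' hb
  have hX : ∀ x ∈ S, ∀ y ∈ S, p x = p a → p y = p b →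
      ((redG G A B X).Adj x y ↔ x ∈ X ∧ y ∈ X) := by
    intro x hx y hy px py
    constructor
    · intro h
      exact h.2 (Or.inl ⟨(mA x).2 ⟨hx, px⟩, (mB y).2 ⟨hy, py⟩⟩)
    · intro h
      refine ⟨hXcl h.1 h.2 ?_, fun _ => h⟩
      rintro rfl
      exact hab (px.symm.trans py)
  have haA : a ∈ A := (mA a).2 ⟨haS, rfl⟩
  have hbB : b ∈ B := (mB b).2 ⟨hbS, rfl⟩
  -- choose the triad
  have hch : (∃ t ∈ A, ∃ t' ∈ B, t ∈ X ∧ t' ∉ X) ∨ (∃ t ∈ A, ∃ t' ∈ B, t ∉ X ∧ t' ∈ X) := by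
    by_contra hcon
    push Not at hcon
    obtain ⟨c1, c2⟩ := hcon
    have eab : a ≠ b := fun h => hab (by rw [h])
    by_cases ha : a ∈ X
    · exact nab (hXcl ha (c1 a haA b hbB ha) eab)
    · have hBX : ∀ t' ∈ B, t' ∉ X := fun t' ht' => c2 a haA t' ht' ha
      have hAX : ∀ t ∈ A, t ∉ X := fun t ht h => hBX b hbB (c1 t ht b hbB h)
      have hXe : X = ∅ := by
        rw [Finset.eq_empty_iff_forall_notMem]
        intro x hx
        rcases Finset.mem_union.1 (hXAB hx) with h | h
        · exact hAX x h hx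
        · exact hBX x h hx
      have hXA0 : A.card ≤ X.card := hXA
      rw [hXe, Finset.card_empty] at hXA0
      have : 0 < A.card := Finset.card_pos.2 ⟨a, haA⟩
      omega
  rcases hch with ⟨t, ht, t', ht', htX, htX'⟩ | ⟨t, ht, t', ht', htX, htX'⟩
  · rw [mA] at ht
    rw [mB] at ht'
    rw [← ht.2] at hab hac h1 h2 hX
    rw [← ht'.2] at hab hbc h1 h3 hX
    exact pair_core hM hG' ht.1 ht'.1 hcS hab hac hbc h1 h2 h3 hX htX htX' hB' ih'
  · rw [mA] at ht
    rw [mB] at ht'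
    rw [← ht.2] at hab hac h1 h2 hX
    rw [← ht'.2] at hab hbc h1 h3 hX
    rw [Sym2.eq_swap] at h1
    refine pair_core hM hG' ht'.1 ht.1 hcS hab.symm hbc hac h1 h3 h2 ?_ htX' htX hB' ih'
    intro x hx y hy px py
    rw [SimpleGraph.adj_comm, hX y hy x hx py px]
    tauto

theorem main_col {V W : Type*} [Finite V] {H : SimpleGraph W} {M : Set (Sym2 W)}
    (hM : ChangeableMatching H M) {p : V → W} (n : ℕ) :
    ∀ S : Finset V, S.card = n → ∀ G : SimpleGraph V, WeakThick H M G p →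
      ∀ k, LocBound G S k → ColOn G S k := by
  classical
  induction n using Nat.strong_induction_on with
  | _ n ihn =>
  intro S hS G hG k hB
  have ih : ∀ S' : Finset V, S'.card < S.card → ∀ G' : SimpleGraph V, WeakThick H M G' p →
      ∀ k', LocBound G' S' k' → ColOn G' S' k' := fun S' h => ihn S'.card (hS ▸ h) S' rfl
  by_cases hα : ∀ a ∈ S, ∀ b ∈ S, ∀ c ∈ S, a ≠ b → a ≠ c → b ≠ c →
      G.Adj a b ∨ G.Adj a c ∨ G.Adj b c
  · exact base_col hα hB
  push Not at hα
  obtain ⟨a, haS, b, hbS, c, hcS, eab, eac, ebc, nab, nac, nbc⟩ := hα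
  have hp : ∀ x y, x ≠ y → ¬G.Adj x y → p x ≠ p y := fun x y hxy hn h => hn (hG.1 x y hxy h)
  have hw : ∀ x y, ¬G.Adj x y → ¬H.Adj (p x) (p y) ∨ s(p x, p y) ∈ M := by
    intro x y hn
    by_contra hcon
    push Not at hcon
    exact hn (hG.2.1 x y hcon.1 hcon.2)
  have nba : ¬G.Adj b a := fun h => nab h.symm
  have nca : ¬G.Adj c a := fun h => nac h.symm
  have ncb : ¬G.Adj c b := fun h => nbc h.symm
  have pab := hp a b eab nab
  have pac := hp a c eac nac
  have pbc := hp b c ebc nbc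
  by_cases m1 : s(p a, p b) ∈ M
  · exact pair_case hM hG haS hbS hcS pab pac pbc nab m1 (hw a c nac) (hw b c nbc) hB ih
  by_cases m2 : s(p a, p c) ∈ M
  · exact pair_case hM hG haS hcS hbS pac pab pbc.symm nac m2 (hw a b nab) (hw c b ncb) hB ih
  by_cases m3 : s(p b, p c) ∈ M
  · exact pair_case hM hG hbS hcS haS pbc pab.symm pac.symm nbc m3 (hw b a nba) (hw c a nca) hB ih
  have q1 := (hw a b nab).resolve_right m1
  have q2 := (hw a c nac).resolve_right m2
  have q3 := (hw b c nbc).resolve_right m3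
  exact triad_case hM hG haS hbS hcS pab pac pbc q1 q2 q3 hB (fun S' h => ih S' h G hG)

theorem locBound_gamma {V : Type*} [Fintype V] (G : SimpleGraph V) :
    LocBound G Finset.univ (gammaLocal G) := by
  intro v _ C _ hcl hvC
  have hω : C.card ≤ omegaAt G v := by
    apply le_csSup
    · refine ⟨Fintype.card V, ?_⟩
      rintro n ⟨s, hs, -⟩
      rw [← hs.card_eq]
      exact Finset.card_le_univ s
    · exact ⟨C, ⟨hcl, rfl⟩, hvC⟩
  have hγ : gammaLocalAt G v ≤ gammaLocal G := by
    apply le_csSup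
    · apply Set.Finite.bddAbove
      apply (Set.finite_range (gammaLocalAt G)).subset
      rintro n ⟨w, rfl⟩
      exact ⟨w, rfl⟩
    · exact ⟨v, rfl⟩
  have hd : {y ∈ ((Finset.univ : Finset V) : Set V) | G.Adj v y}.ncard = degree' G v := by
    unfold degree'
    congr 1
    ext y
    simp
  unfold gammaLocalAt at hγ
  omega

theorem stmt5 {V W : Type*} [Fintype V] (G : SimpleGraph V) (H : SimpleGraph W)
    (M : Set (Sym2 W)) (f : V → W)
    (hH : Antiprismatic H) (hM : ChangeableMatching H M) (ht : IsThickening H M G f) :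
    G.chromaticNumber ≤ (gammaLocal G : ℕ∞) := by
  classical
  have hG : WeakThick H M G f := by
    refine ⟨?_, ?_, ?_⟩
    · intro x y hxy hf
      exact ht.fibers_clique (f x) ⟨trivial, rfl⟩ ⟨trivial, hf.symm⟩ hxy
    · intro x y hxy hn
      exact ht.adj_of_adj x trivial y trivial hxy.ne hxy hn
    · intro x y hne hxy
      by_contra hn
      exact ht.nonadj_of_nonadj x trivial y trivial hne hn hxy
  obtain ⟨c, hc1, hc2⟩ := main_col hM _ Finset.univ rfl G hG _ (locBound_gamma G)
  apply SimpleGraph.Colorable.chromaticNumber_le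
  exact ⟨SimpleGraph.Coloring.mk (fun x => (⟨c x, hc1 x (Finset.mem_univ x)⟩ : Fin (gammaLocal G)))
    (fun {x y} hxy heq => hc2 x (Finset.mem_univ x) y (Finset.mem_univ y) hxy
      (by simpa using heq))⟩

end Paper
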